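/- For every real constant C > 1 there exist a real ε > 0 and a natural number ℓ0 such that for every integer ℓ ≥ ℓ0 and every natural number n ≤ (M_C + ε)^ℓ, there exists a simple graph G on n vertices such that G contains no clique on ℓ vertices and the complement of G contains no clique on ⌈Cℓ⌉ vertices. Equivalently, the Ramsey number r(ℓ, ⌈Cℓ⌉) satisfies r(ℓ, ⌈Cℓ⌉) ≥ (M_C + ε)^ℓ. -/

import Mathlib

/-!
Statement 0: For every real constant `C > 1` there exist `ε > 0` and `ℓ0 : ℕ` such that
for every integer `ℓ ≥ ℓ0` and every `n ≤ (M_C + ε)^ℓ` there is a simple graph on `n`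
vertices with no clique on `ℓ` vertices whose complement has no clique on `⌈Cℓ⌉` vertices;
equivalently `r(ℓ, ⌈Cℓ⌉) ≥ (M_C + ε)^ℓ`.  Here `p_C` is the unique `p ∈ (0, 1/2)` with
`C = log p / log (1 - p)` and `M_C = p_C^{-1/2}`.
-/

/-- `p` is the constant `p_C`: the unique `p ∈ (0,1/2)` with `C = log p / log (1-p)`. -/
def IsPC (C p : ℝ) : Prop :=
  p ∈ Set.Ioo (0 : ℝ) (1 / 2) ∧ C = Real.log p / Real.log (1 - p)

namespace TiltedGraph

open Finset
open scoped BigOperators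

/-- The sign `±1` encoded by a Boolean. -/
def sgn (b : Bool) : ℝ := if b then 1 else -1

lemma sgn_not (b : Bool) : sgn (!b) = -sgn b := by cases b <;> simp [sgn]

lemma sgn_mul_self (b : Bool) : sgn b * sgn b = 1 := by cases b <;> simp [sgn]

lemma sgn_eq (b : Bool) : sgn b = 1 ∨ sgn b = -1 := by cases b <;> simp [sgn]

/-- The product of the two signs at the ends of a pair. -/
def chi {V : Type*} (y : V → Bool) (e : V × V) : ℝ := sgn (y e.1) * sgn (y e.2)

lemma chi_eq {V : Type*} (y : V → Bool) (e : V × V) : chi y e = 1 ∨ chi y e = -1 := by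
  unfold chi
  rcases sgn_eq (y e.1) with h | h <;> rcases sgn_eq (y e.2) with h' | h' <;> simp [h, h']

section Flip

variable {V : Type*} [DecidableEq V]

/-- Reverse the sign at `a`. -/
def flip (a : V) (y : V → Bool) : V → Bool := Function.update y a (!y a)

lemma flip_same (a : V) (y : V → Bool) : flip a y a = !y a := by simp [flip]

lemma flip_of_ne {a b : V} (h : b ≠ a) (y : V → Bool) : flip a y b = y b := by simp [flip, h]

lemma flip_flip (a : V) (y : V → Bool) : flip a (flip a y) = y := by
  funext b
  by_cases h : b = a
  · subst h; simp [flip]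
  · simp [flip, h]

lemma expect_flip [Fintype V] (a : V) (g : (V → Bool) → ℝ) :
    𝔼 y, g (flip a y) = 𝔼 y, g y :=
  Fintype.expect_equiv ⟨flip a, flip a, flip_flip a, flip_flip a⟩ _ _ fun _ => rfl

lemma expect_eq_expect_add_flip [Fintype V] (a : V) (g : (V → Bool) → ℝ) :
    𝔼 y, g y = 𝔼 y, (g y + g (flip a y)) / 2 := by
  rw [← expect_div, expect_add_distrib, expect_flip]; ring

lemma chi_flip_of_mem {a : V} {e : V × V} (he : e.1 ≠ e.2) (h : e.1 = a ∨ e.2 = a)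
    (y : V → Bool) : chi (flip a y) e = -chi y e := by
  unfold chi
  rcases h with h | h
  · subst h; rw [flip_same, flip_of_ne he.symm, sgn_not]; ring
  · subst h; rw [flip_same, flip_of_ne he, sgn_not]; ring

lemma chi_flip_of_notMem {a : V} {e : V × V} (h : ¬(e.1 = a ∨ e.2 = a))
    (y : V → Bool) : chi (flip a y) e = chi y e := by
  push Not at h
  unfold chi; rw [flip_of_ne h.1, flip_of_ne h.2]

/-- The number of pairs of `F` having `a` as an end. -/
def deg (F : Finset (V × V)) (a : V) : ℕ := #{e ∈ F | e.1 = a ∨ e.2 = a}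

lemma expect_prod_chi_eq_zero [Fintype V] {F : Finset (V × V)} (hF : ∀ e ∈ F, e.1 ≠ e.2)
    {a : V} (ha : Odd (deg F a)) : 𝔼 y : V → Bool, ∏ e ∈ F, chi y e = 0 := by
  rw [expect_eq_expect_add_flip a]
  refine expect_eq_zero fun y _ => ?_
  have h : ∏ e ∈ F, chi (flip a y) e = -∏ e ∈ F, chi y e := by
    rw [← prod_filter_mul_prod_filter_not F (fun e => e.1 = a ∨ e.2 = a),
      ← prod_filter_mul_prod_filter_not F (fun e => e.1 = a ∨ e.2 = a) (fun e => chi y e),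
      prod_congr rfl fun e he => chi_flip_of_mem (hF e (mem_filter.1 he).1) (mem_filter.1 he).2 y,
      prod_congr rfl fun e he => chi_flip_of_notMem (mem_filter.1 he).2 y, prod_neg]
    rw [show #{e ∈ F | e.1 = a ∨ e.2 = a} = deg F a from rfl, ha.neg_one_pow]
    ring
  rw [h]; ring

end Flip

/-- The expectation of a product of powers of signs is nonnegative. -/
lemma expect_prod_sgn_pow_nonneg {ι : Type*} [Fintype ι] [DecidableEq ι] (d : ι → ℕ) :
    0 ≤ 𝔼 y : ι → Bool, ∏ i, sgn (y i) ^ d i := by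
  rw [Fintype.expect_eq_sum_div_card]
  refine div_nonneg ?_ (by positivity)
  have := prod_univ_sum (fun _ : ι => (univ : Finset Bool)) (fun i b => sgn b ^ d i)
  rw [Fintype.piFinset_univ] at this
  rw [← this]
  refine prod_nonneg fun i _ => ?_
  rcases neg_one_pow_eq_or ℝ (d i) with h | h <;> simp [sgn, h]

/-- The cone of functions of signs having nonnegative Fourier coefficients. -/
def posCone (ι : Type*) : Subsemiring ((ι → Bool) → ℝ) :=
  Subsemiring.closure ({g | ∃ c : ℝ, 0 ≤ c ∧ g = fun _ => c} ∪ Set.range fun i y => sgn (y i))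

section Cone

variable {ι : Type*}

lemma const_mem_posCone {c : ℝ} (hc : 0 ≤ c) : (fun _ => c) ∈ posCone ι :=
  Subsemiring.subset_closure (Or.inl ⟨c, hc, rfl⟩)

lemma sgn_mem_posCone (i : ι) : (fun y => sgn (y i)) ∈ posCone ι :=
  Subsemiring.subset_closure (Or.inr ⟨i, rfl⟩)

lemma exists_monomial_of_mem_closure [Fintype ι] {f : (ι → Bool) → ℝ}
    (hf : f ∈ Submonoid.closure
      ({g | ∃ c : ℝ, 0 ≤ c ∧ g = fun _ => c} ∪
        Set.range fun (i : ι) (y : ι → Bool) => sgn (y i))) :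
    ∃ c : ℝ, 0 ≤ c ∧ ∃ d : ι → ℕ, f = fun y => c * ∏ i, sgn (y i) ^ d i := by
  classical
  induction hf using Submonoid.closure_induction with
  | mem f hf =>
    rcases hf with ⟨c, hc, rfl⟩ | ⟨i, rfl⟩
    · exact ⟨c, hc, 0, by simp⟩
    · refine ⟨1, zero_le_one, Pi.single i 1, ?_⟩
      funext y
      rw [one_mul, prod_eq_single i] <;> simp +contextual
  | one => exact ⟨1, zero_le_one, 0, by funext y; simp⟩
  | mul f g _ _ hf hg =>
    obtain ⟨c, hc, d, rfl⟩ := hf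
    obtain ⟨c', hc', d', rfl⟩ := hg
    refine ⟨c * c', mul_nonneg hc hc', d + d', ?_⟩
    funext y
    simp only [Pi.mul_apply, Pi.add_apply, pow_add, prod_mul_distrib]
    ring

lemma expect_nonneg_of_mem_posCone [Fintype ι] [DecidableEq ι] {g : (ι → Bool) → ℝ}
    (hg : g ∈ posCone ι) : 0 ≤ 𝔼 y, g y := by
  have hg' : g ∈ AddSubmonoid.closure ((Submonoid.closure
      ({g | ∃ c : ℝ, 0 ≤ c ∧ g = fun _ => c} ∪
        Set.range fun (i : ι) (y : ι → Bool) => sgn (y i)) : Submonoid _) :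
          Set ((ι → Bool) → ℝ)) := by
    rw [← SetLike.mem_coe, ← Subsemiring.coe_closure_eq]
    exact hg
  clear hg
  induction hg' using AddSubmonoid.closure_induction with
  | mem f hf =>
    obtain ⟨c, hc, d, rfl⟩ := exists_monomial_of_mem_closure hf
    rw [← mul_expect]
    exact mul_nonneg hc (expect_prod_sgn_pow_nonneg d)
  | zero => simp
  | add f g _ _ hf hg =>
    simp only [Pi.add_apply, expect_add_distrib]
    exact add_nonneg hf hg

/-- `Dom g g'`: the Fourier coefficients of `g` are bounded in absolute value by those of `g'`. -/
def Dom (g g' : (ι → Bool) → ℝ) : Prop := g' + g ∈ posCone ι ∧ g' - g ∈ posCone ι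

lemma half_smul_mem {g : (ι → Bool) → ℝ} (hg : g + g ∈ posCone ι) : g ∈ posCone ι := by
  have := mul_mem (const_mem_posCone (ι := ι) (c := 1 / 2) (by norm_num)) hg
  convert this using 1
  funext y; simp; ring

lemma Dom.add {f f' g g' : (ι → Bool) → ℝ} (hf : Dom f f') (hg : Dom g g') :
    Dom (f + g) (f' + g') := by
  constructor
  · convert add_mem hf.1 hg.1 using 1; ring
  · convert add_mem hf.2 hg.2 using 1; ring

lemma Dom.neg {f f' : (ι → Bool) → ℝ} (hf : Dom f f') : Dom (-f) f' :=
  ⟨by simpa [sub_eq_add_neg] using hf.2, by simpa using hf.1⟩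

lemma Dom.mul {f f' g g' : (ι → Bool) → ℝ} (hf : Dom f f') (hg : Dom g g') :
    Dom (f * g) (f' * g') := by
  constructor
  · refine half_smul_mem ?_
    convert add_mem (mul_mem hf.1 hg.1) (mul_mem hf.2 hg.2) using 1; ring
  · refine half_smul_mem ?_
    convert add_mem (mul_mem hf.1 hg.2) (mul_mem hf.2 hg.1) using 1; ring

lemma Dom.of_mem {f : (ι → Bool) → ℝ} (hf : f ∈ posCone ι) : Dom f f :=
  ⟨add_mem hf hf, by simp⟩

lemma Dom.prod {κ : Type*} {s : Finset κ} {f f' : κ → (ι → Bool) → ℝ}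
    (h : ∀ k ∈ s, Dom (f k) (f' k)) : Dom (∏ k ∈ s, f k) (∏ k ∈ s, f' k) := by
  classical
  induction s using Finset.induction_on with
  | empty => simpa using Dom.of_mem (one_mem (posCone ι))
  | insert a s ha ih =>
    rw [prod_insert ha, prod_insert ha]
    exact (h a (mem_insert_self _ _)).mul (ih fun k hk => h k (mem_insert_of_mem hk))

/-- Domination of the nonconstant parts of products. -/
lemma Dom.prod_sub_one {κ : Type*} {s : Finset κ} {f f' : κ → (ι → Bool) → ℝ}
    (h : ∀ k ∈ s, Dom (f k - 1) (f' k - 1)) :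
    Dom (∏ k ∈ s, f k - 1) (∏ k ∈ s, f' k - 1) := by
  classical
  induction s using Finset.induction_on with
  | empty => simpa using Dom.of_mem (zero_mem (posCone ι))
  | insert a s ha ih =>
    rw [prod_insert ha, prod_insert ha]
    have h1 := h a (mem_insert_self _ _)
    have h2 := ih fun k hk => h k (mem_insert_of_mem hk)
    convert (h1.mul h2).add (h1.add h2) using 1 <;> ring

lemma Dom.expect_le [Fintype ι] [DecidableEq ι] {f f' : (ι → Bool) → ℝ} (h : Dom f f') :
    𝔼 y, f y ≤ 𝔼 y, f' y := by
  have := expect_nonneg_of_mem_posCone h.2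
  simp only [Pi.sub_apply, expect_sub_distrib] at this
  linarith

end Cone

section Pairs

variable {V : Type*} [LinearOrder V]

/-- The increasing pairs of elements of `S`. -/
def pairs (S : Finset V) : Finset (V × V) := {e ∈ S ×ˢ S | e.1 < e.2}

lemma mem_pairs {S : Finset V} {e : V × V} : e ∈ pairs S ↔ e.1 ∈ S ∧ e.2 ∈ S ∧ e.1 < e.2 := by
  simp [pairs, and_assoc]

lemma pairs_mono {S T : Finset V} (h : S ⊆ T) : pairs S ⊆ pairs T := fun e he => by
  rw [mem_pairs] at *
  exact ⟨h he.1, h he.2.1, he.2.2⟩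

lemma sum_product_self_eq {S : Finset V} (f : V × V → ℝ) (hf : ∀ e, f e.swap = f e) :
    ∑ e ∈ S ×ˢ S, f e = 2 * ∑ e ∈ pairs S, f e + ∑ a ∈ S, f (a, a) := by
  have h1 : ∑ e ∈ S ×ˢ S with ¬e.1 < e.2, f e =
      ∑ e ∈ pairs S, f e + ∑ a ∈ S, f (a, a) := by
    rw [← sum_filter_add_sum_filter_not {e ∈ S ×ˢ S | ¬e.1 < e.2} (fun e => e.2 < e.1)]
    congr 1
    · refine sum_bij' (fun e _ => e.swap) (fun e _ => e.swap) ?_ ?_ ?_ ?_ ?_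
      · simp +contextual [pairs]
      · simp +contextual [pairs, le_of_lt]
      · simp
      · simp
      · intro e _; exact (hf e).symm
    · refine sum_bij' (fun e _ => e.1) (fun a _ => (a, a)) ?_ ?_ ?_ ?_ ?_
      · simp +contextual
      · simp +contextual
      · rintro ⟨a, b⟩ h
        simp only [mem_filter, mem_product, not_lt] at h
        simp [le_antisymm h.2 h.1.2]
      · simp
      · rintro ⟨a, b⟩ h
        simp only [mem_filter, mem_product, not_lt] at h
        simp [le_antisymm h.2 h.1.2]
  rw [← sum_filter_add_sum_filter_not (S ×ˢ S) (fun e => e.1 < e.2), h1, pairs]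
  ring

lemma two_mul_card_pairs (S : Finset V) : 2 * (#(pairs S) : ℝ) = #S * (#S - 1) := by
  have := sum_product_self_eq (S := S) (fun _ => 1) (fun _ => rfl)
  simp only [sum_const, card_product, nsmul_eq_mul, mul_one] at this
  push_cast at this
  linarith

lemma two_mul_sum_chi (S : Finset V) (y : V → Bool) :
    2 * ∑ e ∈ pairs S, chi y e = (∑ a ∈ S, sgn (y a)) ^ 2 - #S := by
  have := sum_product_self_eq (S := S) (chi y) (fun e => by simp [chi, mul_comm])
  rw [sq, sum_mul_sum, ← sum_product', show ∑ x ∈ S ×ˢ S, sgn (y x.1) * sgn (y x.2) =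
    ∑ e ∈ S ×ˢ S, chi y e from rfl, this]
  simp [chi, sgn_mul_self]

/-- The ends of the pairs in `F`. -/
def ends (F : Finset (V × V)) : Finset V := F.image Prod.fst ∪ F.image Prod.snd

lemma mem_ends {F : Finset (V × V)} {a : V} : a ∈ ends F ↔ ∃ e ∈ F, e.1 = a ∨ e.2 = a := by
  simp only [ends, mem_union, mem_image]
  grind

lemma subset_pairs_ends {F : Finset (V × V)} (hF : ∀ e ∈ F, e.1 < e.2) : F ⊆ pairs (ends F) :=
  fun e he => mem_pairs.2 ⟨mem_ends.2 ⟨e, he, Or.inl rfl⟩, mem_ends.2 ⟨e, he, Or.inr rfl⟩, hF e he⟩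

lemma sum_deg {F : Finset (V × V)} (hF : ∀ e ∈ F, e.1 < e.2) :
    ∑ a ∈ ends F, deg F a = 2 * #F := by
  have := sum_card_bipartiteAbove_eq_sum_card_bipartiteBelow (s := ends F) (t := F)
    (fun a e => e.1 = a ∨ e.2 = a)
  simp only [bipartiteAbove, bipartiteBelow] at this
  unfold deg
  rw [this, mul_comm, ← smul_eq_mul, ← sum_const]
  refine sum_congr rfl fun e he => ?_
  rw [← card_pair (hF e he).ne]
  congr 1
  ext a
  simp only [mem_filter, mem_insert, mem_singleton, mem_ends]
  grind

lemma card_ends_le {F : Finset (V × V)} (hF : ∀ e ∈ F, e.1 < e.2) (hd : ∀ a, Even (deg F a)) :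
    #(ends F) ≤ #F := by
  have h : ∑ a ∈ ends F, 2 ≤ ∑ a ∈ ends F, deg F a := by
    refine sum_le_sum fun a ha => ?_
    obtain ⟨e, he, h⟩ := mem_ends.1 ha
    have h1 : 0 < deg F a := card_pos.2 ⟨e, mem_filter.2 ⟨he, h⟩⟩
    obtain ⟨k, hk⟩ := hd a
    omega
  rw [sum_deg hF] at h
  simp at h
  omega

lemma card_mul_card_sub_one {F : Finset (V × V)} (hF : ∀ e ∈ F, e.1 < e.2) :
    2 * #F + #(ends F) ≤ #(ends F) * #(ends F) := by
  have h := card_le_card (subset_pairs_ends hF)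
  have h2 := two_mul_card_pairs (ends F)
  have h3 : ((2 * #F + #(ends F) : ℕ) : ℝ) ≤ (#(ends F) * #(ends F) : ℕ) := by
    push_cast
    have : (#F : ℝ) ≤ #(pairs (ends F)) := by exact_mod_cast h
    nlinarith
  exact_mod_cast h3

lemma two_lt_card_of_even {F : Finset (V × V)} (hF : ∀ e ∈ F, e.1 < e.2)
    (hd : ∀ a, Even (deg F a)) (hne : F ≠ ∅) : 2 < #F := by
  have h1 := card_ends_le hF hd
  have h2 := card_mul_card_sub_one hF
  have h3 := card_pos.2 (nonempty_of_ne_empty hne)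
  by_contra! h
  have h4 : #(ends F) ≤ 2 := h1.trans h
  interval_cases #(ends F) <;> omega

lemma eq_pairs_of_even {F : Finset (V × V)} (hF : ∀ e ∈ F, e.1 < e.2)
    (hd : ∀ a, Even (deg F a)) (h3 : #F = 3) : #(ends F) = 3 ∧ F = pairs (ends F) := by
  have h1 := card_ends_le hF hd
  have h2 := card_mul_card_sub_one hF
  rw [h3] at h1 h2
  have hc : #(ends F) = 3 := by interval_cases #(ends F) <;> omega
  refine ⟨hc, eq_of_subset_of_card_le (subset_pairs_ends hF) ?_⟩
  have := two_mul_card_pairs (ends F)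
  rw [hc] at this
  have h4 : (#(pairs (ends F)) : ℝ) = 3 := by push_cast at this; linarith
  rw [h3]
  exact_mod_cast h4.le

lemma exists_sorted_of_card_eq_three {τ : Finset V} (h : #τ = 3) :
    ∃ i j k, i < j ∧ j < k ∧ τ = {i, j, k} := by
  obtain ⟨a, b, c, hab, hac, hbc, rfl⟩ := card_eq_three.1 h
  rcases hab.lt_or_gt with h1 | h1 <;> rcases hac.lt_or_gt with h2 | h2 <;>
    rcases hbc.lt_or_gt with h3 | h3
  · exact ⟨a, b, c, h1, h3, rfl⟩
  · exact ⟨a, c, b, h2, h3, by grind⟩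
  · exact absurd (h1.trans h3) h2.asymm
  · exact ⟨c, a, b, h2, h1, by grind⟩
  · exact ⟨b, a, c, h1, h2, by grind⟩
  · exact absurd (h2.trans h3) h1.asymm
  · exact ⟨b, c, a, h3, h2, by grind⟩
  · exact ⟨c, b, a, h3, h1, by grind⟩

lemma pairs_triple {i j k : V} (hij : i < j) (hjk : j < k) :
    pairs {i, j, k} = {(i, j), (i, k), (j, k)} := by
  ext ⟨a, b⟩
  simp only [mem_pairs, mem_insert, mem_singleton, Prod.mk.injEq]
  grind

lemma ends_pairs_of_card_eq_three {τ : Finset V} (h : #τ = 3) : ends (pairs τ) = τ := by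
  obtain ⟨i, j, k, hij, hjk, rfl⟩ := exists_sorted_of_card_eq_three h
  rw [pairs_triple hij hjk]
  ext a
  simp only [ends, image_insert, image_singleton, mem_union, mem_insert, mem_singleton]
  tauto

lemma card_pairs_of_card_eq_three {τ : Finset V} (h : #τ = 3) : #(pairs τ) = 3 := by
  have := two_mul_card_pairs τ
  rw [h] at this
  have h4 : (#(pairs τ) : ℝ) = 3 := by push_cast at this; linarith
  exact_mod_cast h4

lemma prod_chi_pairs_of_card_eq_three {τ : Finset V} (h : #τ = 3) (y : V → Bool) :
    ∏ e ∈ pairs τ, chi y e = 1 := by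
  obtain ⟨i, j, k, hij, hjk, rfl⟩ := exists_sorted_of_card_eq_three h
  rw [pairs_triple hij hjk, prod_insert, prod_insert, prod_singleton]
  · simp only [chi]
    have h1 := sgn_mul_self (y i)
    have h2 := sgn_mul_self (y j)
    have h3 := sgn_mul_self (y k)
    linear_combination (sgn (y j) * sgn (y j) * sgn (y k) * sgn (y k)) * h1 +
      (sgn (y k) * sgn (y k)) * h2 + h3
  · simp [hij.ne]
  · simp [hjk.ne]

end Pairs

section Walsh

variable {V : Type*} [Fintype V] [LinearOrder V]

/-- The expectation of a product of pair characters. -/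
noncomputable def eps (F : Finset (V × V)) : ℝ := 𝔼 y : V → Bool, ∏ e ∈ F, chi y e

lemma eps_nonneg (F : Finset (V × V)) : 0 ≤ eps F := by
  refine expect_nonneg_of_mem_posCone (g := fun y => ∏ e ∈ F, chi y e) ?_
  have : (∏ e ∈ F, ((fun y => sgn (y e.1)) * fun y => sgn (y e.2) : (V → Bool) → ℝ)) ∈
      posCone V :=
    prod_mem fun e _ => mul_mem (sgn_mem_posCone _) (sgn_mem_posCone _)
  convert this using 1
  funext y
  simp [prod_apply, chi]

lemma eps_empty : eps (∅ : Finset (V × V)) = 1 := by simp [eps]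

lemma even_deg_of_eps_ne_zero {F : Finset (V × V)} (hF : ∀ e ∈ F, e.1 < e.2) (h : eps F ≠ 0)
    (a : V) : Even (deg F a) := by
  by_contra ha
  exact h (expect_prod_chi_eq_zero (fun e he => (hF e he).ne) (Nat.not_even_iff_odd.1 ha))

/-- The single-coordinate partition function. -/
noncomputable def part (P : Finset (V × V)) (v : V × V → ℝ) : ℝ :=
  𝔼 y : V → Bool, ∏ e ∈ P, (1 + v e * chi y e)

lemma part_eq_sum (P : Finset (V × V)) (v : V × V → ℝ) :
    part P v = ∑ F ∈ P.powerset, (∏ e ∈ F, v e) * eps F := by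
  simp only [part, prod_one_add, expect_sum_comm, prod_mul_distrib, eps, mul_expect]

lemma sum_powersetCard_three (S : Finset V) (v : V × V → ℝ) :
    ∑ F ∈ (pairs S).powersetCard 3, (∏ e ∈ F, v e) * eps F =
      ∑ τ ∈ S.powersetCard 3, ∏ e ∈ pairs τ, v e := by
  symm
  have hinj : Set.InjOn pairs (S.powersetCard 3 : Set (Finset V)) := by
    intro τ hτ τ' hτ' h
    rw [← ends_pairs_of_card_eq_three (mem_powersetCard.1 hτ).2, h,
      ends_pairs_of_card_eq_three (mem_powersetCard.1 hτ').2]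
  have h1 : ∑ τ ∈ S.powersetCard 3, ∏ e ∈ pairs τ, v e =
      ∑ F ∈ (S.powersetCard 3).image pairs, (∏ e ∈ F, v e) * eps F := by
    rw [sum_image hinj]
    refine sum_congr rfl fun τ hτ => ?_
    simp [eps, prod_chi_pairs_of_card_eq_three (mem_powersetCard.1 hτ).2]
  rw [h1]
  refine sum_subset ?_ ?_
  · intro F hF
    obtain ⟨τ, hτ, rfl⟩ := mem_image.1 hF
    rw [mem_powersetCard] at *
    exact ⟨pairs_mono hτ.1, card_pairs_of_card_eq_three hτ.2⟩
  · intro F hF hF'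
    rw [mem_powersetCard] at hF
    have hlt : ∀ e ∈ F, e.1 < e.2 := fun e he => (mem_pairs.1 (hF.1 he)).2.2
    by_contra hne
    have hd := even_deg_of_eps_ne_zero hlt (right_ne_zero_of_mul hne)
    obtain ⟨hc, hFe⟩ := eq_pairs_of_even hlt hd hF.2
    refine hF' (mem_image.2 ⟨ends F, mem_powersetCard.2 ⟨?_, hc⟩, hFe.symm⟩)
    intro a ha
    obtain ⟨e, he, h⟩ := mem_ends.1 ha
    have := mem_pairs.1 (hF.1 he)
    rcases h with rfl | rfl
    · exact this.1
    · exact this.2.1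

lemma part_eq_triangles_add (S : Finset V) (v : V × V → ℝ) :
    part (pairs S) v = 1 + ∑ τ ∈ S.powersetCard 3, ∏ e ∈ pairs τ, v e +
      ∑ F ∈ (pairs S).powerset with 4 ≤ #F, (∏ e ∈ F, v e) * eps F := by
  rw [part_eq_sum, ← sum_filter_add_sum_filter_not (pairs S).powerset (fun F => 4 ≤ #F), add_comm,
    ← sum_powersetCard_three]
  congr 1
  have hdisj : (∅ : Finset (V × V)) ∉ (pairs S).powersetCard 3 := by
    simp [mem_powersetCard]
  have h1 : 1 + ∑ F ∈ (pairs S).powersetCard 3, (∏ e ∈ F, v e) * eps F =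
      ∑ F ∈ insert ∅ ((pairs S).powersetCard 3), (∏ e ∈ F, v e) * eps F := by
    rw [sum_insert hdisj]; simp [eps_empty]
  rw [h1]
  symm
  refine sum_subset ?_ ?_
  · intro F hF
    rcases mem_insert.1 hF with rfl | hF
    · simp
    · rw [mem_powersetCard] at hF
      simp [hF.1, hF.2]
  · intro F hF hF'
    simp only [mem_filter, mem_powerset, not_le] at hF
    have hlt : ∀ e ∈ F, e.1 < e.2 := fun e he => (mem_pairs.1 (hF.1 he)).2.2
    by_contra hne
    have hd := even_deg_of_eps_ne_zero hlt (right_ne_zero_of_mul hne)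
    simp only [mem_insert, mem_powersetCard, not_or] at hF'
    have := two_lt_card_of_even hlt hd hF'.1
    exact hF'.2 ⟨hF.1, by omega⟩

end Walsh

section SubGaussian

variable {V : Type*} [Fintype V] [LinearOrder V]

lemma expect_exp_mul_sq_le (S : Finset V) {K : ℝ} (hK : 0 < K) {r : ℝ} (hr0 : 0 ≤ r)
    (hr : r * (2 * #S + K) ≤ 1) :
    𝔼 y : V → Bool, Real.exp (r * (∑ a ∈ S, sgn (y a)) ^ 2) ≤ Real.exp (#S / K) := by
  induction S using Finset.induction_on generalizing r with
  | empty => simp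
  | insert a S ha ih =>
    rw [card_insert_of_notMem ha] at hr ⊢
    push_cast at hr ⊢
    have hstep : ∀ y : V → Bool,
        (Real.exp (r * (∑ b ∈ insert a S, sgn (y b)) ^ 2) +
          Real.exp (r * (∑ b ∈ insert a S, sgn (flip a y b)) ^ 2)) / 2 ≤
        Real.exp r * Real.exp ((r + 2 * r ^ 2) * (∑ b ∈ S, sgn (y b)) ^ 2) := by
      intro y
      have hflip : ∑ b ∈ S, sgn (flip a y b) = ∑ b ∈ S, sgn (y b) :=
        sum_congr rfl fun b hb => by rw [flip_of_ne (ne_of_mem_of_not_mem hb ha)]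
      rw [sum_insert ha, sum_insert ha, flip_same, sgn_not, hflip]
      set Y := ∑ b ∈ S, sgn (y b)
      have hs := sgn_mul_self (y a)
      set s := sgn (y a)
      have h1 : r * (s + Y) ^ 2 = r + r * Y ^ 2 + 2 * r * s * Y := by
        linear_combination r * hs
      have h2 : r * (-s + Y) ^ 2 = r + r * Y ^ 2 + -(2 * r * s * Y) := by
        linear_combination r * hs
      rw [h1, h2, Real.exp_add _ (2 * r * s * Y), Real.exp_add _ (-(2 * r * s * Y)), ← mul_add,
        mul_div_assoc, ← Real.cosh_eq]
      calc _ ≤ Real.exp (r + r * Y ^ 2) * Real.exp ((2 * r * s * Y) ^ 2 / 2) := by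
            gcongr
            exact Real.cosh_le_exp_half_sq _
        _ = _ := by
            rw [← Real.exp_add, ← Real.exp_add]
            congr 1
            linear_combination (2 * r ^ 2 * Y ^ 2) * hs
    have hD : (0 : ℝ) ≤ #S := Nat.cast_nonneg _
    have hrK : r ≤ 1 / K := by
      rw [le_div_iff₀ hK]
      nlinarith
    have h3 := ih (r := r + 2 * r ^ 2) (by positivity) (by
      have : r * (2 * #S + K) ≤ 1 - 2 * r := by linarith
      have h4 : (1 + 2 * r) * (r * (2 * #S + K)) ≤ (1 + 2 * r) * (1 - 2 * r) := by gcongr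
      nlinarith [sq_nonneg r])
    rw [expect_eq_expect_add_flip a]
    calc _ ≤ 𝔼 y : V → Bool,
          Real.exp r * Real.exp ((r + 2 * r ^ 2) * (∑ b ∈ S, sgn (y b)) ^ 2) :=
          expect_le_expect fun y _ => hstep y
      _ ≤ Real.exp (1 / K) * Real.exp (#S / K) := by
          rw [← mul_expect]
          gcongr
      _ = _ := by
          rw [← Real.exp_add]
          congr 1
          ring

lemma part_const_le_two {S : Finset V} (hS : S.Nonempty) :
    part (pairs S) (fun _ => 1 / (2 * (#S : ℝ))) ≤ 2 := by
  have hs : (1 : ℝ) ≤ #S := by exact_mod_cast hS.card_pos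
  have hs0 : (0 : ℝ) < #S := by linarith
  have hr1 : 1 / (2 * (#S : ℝ)) ≤ 1 := by
    rw [div_le_one (by positivity)]; linarith
  have hr0 : 0 ≤ 1 / (2 * (#S : ℝ)) := by positivity
  have h1 : ∀ y : V → Bool, ∏ e ∈ pairs S, (1 + 1 / (2 * (#S : ℝ)) * chi y e) ≤
      Real.exp (1 / (4 * #S) * (∑ a ∈ S, sgn (y a)) ^ 2) := by
    intro y
    calc _ ≤ ∏ e ∈ pairs S, Real.exp (1 / (2 * (#S : ℝ)) * chi y e) := by
          refine prod_le_prod (fun e _ => ?_) fun e _ => ?_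
          · rcases chi_eq y e with h | h <;> rw [h] <;> linarith
          · rw [add_comm]; exact Real.add_one_le_exp _
      _ ≤ _ := by
          rw [← Real.exp_sum, ← mul_sum, Real.exp_le_exp]
          have h2 := two_mul_sum_chi S y
          have h3 : ∑ e ∈ pairs S, chi y e ≤ (∑ a ∈ S, sgn (y a)) ^ 2 / 2 := by linarith
          calc _ ≤ 1 / (2 * (#S : ℝ)) * ((∑ a ∈ S, sgn (y a)) ^ 2 / 2) := by gcongr
            _ = _ := by field_simp; ring
  have h2 := expect_exp_mul_sq_le S (K := 2 * #S) (by positivity) (r := 1 / (4 * #S))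
    (by positivity) (by apply le_of_eq; field_simp; norm_num)
  have h3 : (#S : ℝ) / (2 * #S) = 1 / 2 := by field_simp
  rw [h3] at h2
  have h4 : Real.exp (1 / 2) ≤ 2 := by
    have h5 : Real.exp (1 / 2) * Real.exp (1 / 2) = Real.exp 1 := by
      rw [← Real.exp_add]; norm_num
    nlinarith [Real.exp_one_lt_d9, Real.exp_pos (1 / 2)]
  exact (expect_le_expect fun y _ => h1 y).trans (h2.trans h4)

lemma part_le {S : Finset V} (hS : S.Nonempty) {v : V × V → ℝ} {r : ℝ}
    (hv : ∀ e ∈ pairs S, |v e| ≤ r) (hr0 : 0 ≤ r) (hr : 2 * #S * r ≤ 1) :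
    part (pairs S) v ≤
      1 + ∑ τ ∈ S.powersetCard 3, ∏ e ∈ pairs τ, v e + 32 * (#S * r) ^ 4 := by
  rw [part_eq_triangles_add]
  have hs0 : (0 : ℝ) < #S := by exact_mod_cast hS.card_pos
  set u : ℝ := 1 / (2 * #S)
  have hu : 0 ≤ u := by positivity
  have hru : (2 * #S * r) * u = r := by simp only [u]; field_simp
  have h0 : 0 ≤ 2 * #S * r := by positivity
  have key : ∑ F ∈ (pairs S).powerset with 4 ≤ #F, (∏ e ∈ F, v e) * eps F ≤
      (2 * #S * r) ^ 4 * part (pairs S) fun _ => u := by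
    rw [part_eq_sum, mul_sum]
    calc _ ≤ ∑ F ∈ (pairs S).powerset with 4 ≤ #F,
          (2 * #S * r) ^ 4 * ((∏ e ∈ F, u) * eps F) := by
          refine sum_le_sum fun F hF => ?_
          rw [mem_filter, mem_powerset] at hF
          rw [← mul_assoc]
          refine mul_le_mul_of_nonneg_right ?_ (eps_nonneg F)
          calc ∏ e ∈ F, v e ≤ ∏ e ∈ F, |v e| := by
                rw [← abs_prod]; exact le_abs_self _
            _ ≤ ∏ e ∈ F, r := prod_le_prod (fun _ _ => abs_nonneg _) fun e he => hv e (hF.1 he)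
            _ = (2 * #S * r) ^ #F * u ^ #F := by
                rw [prod_const, ← mul_pow, hru]
            _ ≤ (2 * #S * r) ^ 4 * u ^ #F := by
                gcongr ?_ * _
                exact pow_le_pow_of_le_one h0 hr hF.2
            _ = _ := by rw [prod_const]
      _ ≤ _ := by
          refine sum_le_sum_of_subset_of_nonneg (filter_subset _ _) fun F _ _ => ?_
          have := eps_nonneg F
          positivity
  have h2 := part_const_le_two hS
  have h3 : (2 * #S * r) ^ 4 * part (pairs S) (fun _ => u) ≤ (2 * #S * r) ^ 4 * 2 := by gcongr
  have h4 : (2 * #S * r) ^ 4 * 2 = 32 * (#S * r) ^ 4 := by ring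
  linarith

lemma part_nonneg {P : Finset (V × V)} {v : V × V → ℝ} (hv : ∀ e ∈ P, |v e| ≤ 1) :
    0 ≤ part P v := by
  refine expect_nonneg fun y _ => prod_nonneg fun e he => ?_
  have := abs_le.1 (hv e he)
  rcases chi_eq y e with h | h <;> rw [h] <;> linarith

lemma part_le_exp {S : Finset V} (hS : S.Nonempty) {v : V × V → ℝ} {r : ℝ}
    (hv : ∀ e ∈ pairs S, |v e| ≤ r) (hr0 : 0 ≤ r) (hr : 2 * #S * r ≤ 1) (m : ℕ) :
    part (pairs S) v ^ m ≤
      Real.exp (m * (∑ τ ∈ S.powersetCard 3, ∏ e ∈ pairs τ, v e + 32 * (#S * r) ^ 4)) := by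
  rw [Real.exp_nat_mul]
  have hs : (1 : ℝ) ≤ #S := by exact_mod_cast hS.card_pos
  have hr1 : r ≤ 1 := by nlinarith
  refine pow_le_pow_left₀ (part_nonneg fun e he => (hv e he).trans hr1) ?_ m
  refine (part_le hS hv hr0 hr).trans ?_
  rw [add_assoc, add_comm]
  exact Real.add_one_le_exp _

/-- Independent coordinates: the expectation of a product over the coordinates factors. -/
lemma expect_prod_curry {V K : Type*} [Fintype V] [DecidableEq V] [Fintype K] [DecidableEq K]
    (g : K → (V → Bool) → ℝ) :
    𝔼 x : K × V → Bool, ∏ k, g k (fun a => x (k, a)) = ∏ k, 𝔼 y, g k y := by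
  rw [Fintype.expect_equiv (Equiv.curry K V Bool) _ (fun z => ∏ k, g k (z k)) fun x => (rfl :
    ∏ k, g k (fun a => x (k, a)) = ∏ k, g k ((Equiv.curry K V Bool x) k))]
  simp only [Fintype.expect_eq_sum_div_card]
  rw [prod_div_distrib, prod_univ_sum, Fintype.piFinset_univ]
  simp

lemma expect_prod_prod_chi (P : Finset (V × V)) (v : V × V → ℝ) (m : ℕ) :
    𝔼 x : Fin m × V → Bool, ∏ e ∈ P, ∏ k, (1 + v e * chi (fun a => x (k, a)) e) =
      part P v ^ m := by
  simp_rw [prod_comm (s := P)]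
  rw [expect_prod_curry (fun _ y => ∏ e ∈ P, (1 + v e * chi y e))]
  simp [part]

end SubGaussian

section ProductWeight

variable {E J : Type*} [Fintype E] [DecidableEq E] [Fintype J]

/-- The average of `X` when the coordinate at `e` is drawn independently with weights `μ e`. -/
def avg (μ : E → J → ℝ) (X : (E → J) → ℝ) : ℝ := ∑ s : E → J, (∏ e, μ e (s e)) * X s

lemma avg_mono {μ : E → J → ℝ} (hμ : ∀ e j, 0 ≤ μ e j) {X Y : (E → J) → ℝ}
    (h : ∀ s, X s ≤ Y s) : avg μ X ≤ avg μ Y :=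
  sum_le_sum fun s _ => mul_le_mul_of_nonneg_left (h s) (prod_nonneg fun e _ => hμ e (s e))

lemma avg_const_mul (μ : E → J → ℝ) (c : ℝ) (X : (E → J) → ℝ) :
    avg μ (fun s => c * X s) = c * avg μ X := by
  simp only [avg, mul_sum]
  exact sum_congr rfl fun s _ => by ring

lemma avg_sum {κ : Type*} (μ : E → J → ℝ) (t : Finset κ) (X : κ → (E → J) → ℝ) :
    avg μ (fun s => ∑ i ∈ t, X i s) = ∑ i ∈ t, avg μ (X i) := by
  simp only [avg, mul_sum]
  exact sum_comm

lemma avg_prod {μ : E → J → ℝ} (hμ : ∀ e, ∑ j, μ e j = 1) (A : Finset E) (φ : E → J → ℝ) :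
    avg μ (fun s => ∏ e ∈ A, φ e (s e)) = ∏ e ∈ A, ∑ j, μ e j * φ e j := by
  have h1 : ∏ e ∈ A, ∑ j, μ e j * φ e j =
      ∏ e, ∑ j, μ e j * (if e ∈ A then φ e j else 1) := by
    rw [← prod_subset (subset_univ A)]
    · exact prod_congr rfl fun e he => by simp [he]
    · intro e _ he
      simp [he, hμ]
  rw [h1, prod_univ_sum, Fintype.piFinset_univ]
  refine sum_congr rfl fun s _ => ?_
  rw [prod_mul_distrib]
  congr 1
  rw [prod_ite_mem, univ_inter]

lemma avg_const {μ : E → J → ℝ} (hμ : ∀ e, ∑ j, μ e j = 1) (c : ℝ) :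
    avg μ (fun _ => c) = c := by
  have h := avg_prod hμ ∅ fun _ _ => 1
  have h1 := avg_const_mul μ c fun _ => 1
  simp only [prod_empty] at h
  simpa [h] using h1

end ProductWeight

section Classes

variable {V : Type*} [LinearOrder V]

lemma exists_injOn_lt_card (S : Finset V) :
    ∃ f : V → ℕ, (∀ a ∈ S, f a < #S) ∧ Set.InjOn f S := by
  refine ⟨fun a => if h : a ∈ S then (S.equivFin ⟨a, h⟩ : ℕ) else 0, fun a ha => ?_,
    fun a ha b hb h => ?_⟩
  · simp [ha]
  · rw [mem_coe] at ha hb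
    simpa [ha, hb, Fin.val_inj] using h

lemma exists_eq_insert_of_mem_pairs {τ : Finset V} (h : #τ = 3) {e : V × V} (he : e ∈ pairs τ) :
    ∃ c ∈ τ, c ≠ e.1 ∧ c ≠ e.2 ∧ τ = {c, e.1, e.2} := by
  obtain ⟨h1, h2, h3⟩ := mem_pairs.1 he
  have hsub : ({e.1, e.2} : Finset V) ⊆ τ := by
    intro a; simp only [mem_insert, mem_singleton]; rintro (rfl | rfl) <;> assumption
  have hc : #(τ \ {e.1, e.2}) = 1 := by
    rw [card_sdiff_of_subset hsub, card_pair h3.ne, h]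
  obtain ⟨c, hc⟩ := card_eq_one.1 hc
  have hcm : c ∈ τ \ {e.1, e.2} := by rw [hc]; exact mem_singleton_self c
  simp only [mem_sdiff, mem_insert, mem_singleton, not_or] at hcm
  refine ⟨c, hcm.1, hcm.2.1, hcm.2.2, ?_⟩
  have := sdiff_union_of_subset hsub
  rw [hc] at this
  rw [← this]
  rfl

/-- Triples with the same residue of the sum of labels have disjoint sets of pairs. -/
lemma disjoint_pairs_of_modEq {S : Finset V} {f : V → ℕ} (hf : ∀ a ∈ S, f a < #S)
    (hinj : Set.InjOn f S) {τ τ' : Finset V} (hτ : τ ∈ S.powersetCard 3)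
    (hτ' : τ' ∈ S.powersetCard 3) (hne : τ ≠ τ')
    (h : ∑ a ∈ τ, f a ≡ ∑ a ∈ τ', f a [MOD #S]) : Disjoint (pairs τ) (pairs τ') := by
  rw [mem_powersetCard] at hτ hτ'
  rw [disjoint_left]
  intro e he he'
  obtain ⟨c, hc, hc1, hc2, hceq⟩ := exists_eq_insert_of_mem_pairs hτ.2 he
  obtain ⟨d, hd, hd1, hd2, hdeq⟩ := exists_eq_insert_of_mem_pairs hτ'.2 he'
  rw [hceq, hdeq, sum_insert (a := c) (by simp [hc1, hc2]),
    sum_insert (a := d) (by simp [hd1, hd2])] at h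
  have h1 := Nat.ModEq.add_right_cancel' _ h
  have h2 := Nat.ModEq.eq_of_lt_of_lt h1 (hf c (hτ.1 hc)) (hf d (hτ'.1 hd))
  have h3 := hinj (hτ.1 hc) (hτ'.1 hd) h2
  exact hne (by rw [hceq, hdeq, h3])

lemma three_mul_card_le {S : Finset V} {A : Finset (Finset V)} (hA : A ⊆ S.powersetCard 3)
    (hd : (A : Set (Finset V)).PairwiseDisjoint pairs) : 3 * #A ≤ #(pairs S) := by
  have h1 : #(A.biUnion pairs) = 3 * #A := by
    rw [card_biUnion hd, sum_congr rfl fun τ hτ =>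
      card_pairs_of_card_eq_three (mem_powersetCard.1 (hA hτ)).2]
    simp [mul_comm]
  rw [← h1]
  exact card_le_card (biUnion_subset.2 fun τ hτ => pairs_mono (mem_powersetCard.1 (hA hτ)).1)

variable [Fintype V] {J : Type*} [Fintype J]

lemma exp_mul_le_one_add {x y u U : ℝ} (hx : 0 ≤ x) (hu : 0 ≤ u) (huU : u ≤ U) (hxU : x * U ≤ 1)
    (hy : y = x * (1 + x * U)) : Real.exp (x * u) ≤ 1 + y * u := by
  have h0 : 0 ≤ x * u := by positivity
  have h1 : x * u ≤ x * U := by gcongr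
  have h2 := abs_le.1 (Real.abs_exp_sub_one_sub_id_le (x := x * u) (by
    rw [abs_of_nonneg h0]; linarith))
  have h3 : (x * u) * (x * u) ≤ (x * u) * (x * U) := by gcongr
  rw [hy]
  nlinarith [h2.2]

lemma avg_exp_class_le {μ : J → ℝ} (hμ0 : ∀ j, 0 ≤ μ j) (hμ : ∑ j, μ j = 1) {v : J → ℝ} {r : ℝ}
    (hv0 : ∀ j, 0 ≤ v j) (hv : ∀ j, v j ≤ r) {x : ℝ} (hx : 0 ≤ x) (hxr : x * r ^ 3 ≤ 1)
    {S : Finset V} {A : Finset (Finset V)} (hA : A ⊆ S.powersetCard 3)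
    (hd : (A : Set (Finset V)).PairwiseDisjoint pairs) :
    avg (fun _ : V × V => μ) (fun s => Real.exp (x * ∑ τ ∈ A, ∏ e ∈ pairs τ, v (s e))) ≤
      Real.exp (x * (1 + x * r ^ 3) * (∑ j, μ j * v j) ^ 3 * (#(pairs S) / 3)) := by
  obtain ⟨y, hy⟩ : ∃ y, y = x * (1 + x * r ^ 3) := ⟨_, rfl⟩
  rw [← hy]
  set w := ∑ j, μ j * v j
  have hJ : Nonempty J := by
    by_contra hJ
    rw [not_nonempty_iff] at hJ
    simp at hμ
  have hr : 0 ≤ r := (hv0 hJ.some).trans (hv _)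
  have hy0 : 0 ≤ y := by rw [hy]; positivity
  have hw0 : 0 ≤ w := sum_nonneg fun j _ => mul_nonneg (hμ0 j) (hv0 j)
  have h1 : ∀ s : V × V → J, Real.exp (x * ∑ τ ∈ A, ∏ e ∈ pairs τ, v (s e)) ≤
      ∏ τ ∈ A, (1 + y * ∏ e ∈ pairs τ, v (s e)) := by
    intro s
    rw [mul_sum, Real.exp_sum]
    refine prod_le_prod (fun _ _ => (Real.exp_pos _).le) fun τ hτ => ?_
    refine exp_mul_le_one_add (U := r ^ 3) hx (prod_nonneg fun _ _ => hv0 _) ?_ hxr hy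
    calc _ ≤ ∏ e ∈ pairs τ, r := prod_le_prod (fun _ _ => hv0 _) fun _ _ => hv _
      _ = r ^ 3 := by
        rw [prod_const, card_pairs_of_card_eq_three (mem_powersetCard.1 (hA hτ)).2]
  have h2 : ∀ B ∈ A.powerset, avg (fun _ : V × V => μ)
      (fun s => ∏ τ ∈ B, (y * ∏ e ∈ pairs τ, v (s e))) = ∏ τ ∈ B, (y * w ^ 3) := by
    intro B hB
    rw [mem_powerset] at hB
    have hdB : (B : Set (Finset V)).PairwiseDisjoint pairs := hd.subset (by exact_mod_cast hB)
    have h3 : ∀ s : V × V → J, ∏ τ ∈ B, (y * ∏ e ∈ pairs τ, v (s e)) =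
        (∏ τ ∈ B, y) * ∏ e ∈ B.biUnion pairs, v (s e) := by
      intro s
      rw [prod_mul_distrib, prod_biUnion hdB]
    simp_rw [h3]
    rw [avg_const_mul, avg_prod (fun _ => hμ) (B.biUnion pairs) fun _ j => v j,
      prod_mul_distrib, prod_biUnion hdB]
    refine congrArg _ (prod_congr rfl fun τ hτ => ?_)
    rw [prod_const, card_pairs_of_card_eq_three (mem_powersetCard.1 (hA (hB hτ))).2]
  calc _ ≤ avg (fun _ : V × V => μ) fun s => ∏ τ ∈ A, (1 + y * ∏ e ∈ pairs τ, v (s e)) :=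
        avg_mono (fun _ => hμ0) h1
    _ = (1 + y * w ^ 3) ^ #A := by
        simp_rw [prod_one_add]
        rw [avg_sum, sum_congr rfl h2, ← prod_one_add, prod_const]
    _ ≤ Real.exp (y * w ^ 3) ^ #A := by
        gcongr
        rw [add_comm]
        exact Real.add_one_le_exp _
    _ = Real.exp (y * w ^ 3 * #A) := by
        rw [← Real.exp_nat_mul, mul_comm]
    _ ≤ _ := by
        have h4 := three_mul_card_le hA hd
        have h5 : (3 * #A : ℝ) ≤ #(pairs S) := by exact_mod_cast h4
        gcongr
        linarith

lemma avg_exp_triangles_le {μ : J → ℝ} (hμ0 : ∀ j, 0 ≤ μ j) (hμ : ∑ j, μ j = 1) {v : J → ℝ}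
    {r : ℝ} (hv0 : ∀ j, 0 ≤ v j) (hv : ∀ j, v j ≤ r) {S : Finset V} (hS : S.Nonempty) {m : ℝ}
    (hm : 0 ≤ m) (hmr : #S * m * r ^ 3 ≤ 1) :
    avg (fun _ : V × V => μ)
      (fun s => Real.exp (m * ∑ τ ∈ S.powersetCard 3, ∏ e ∈ pairs τ, v (s e))) ≤
      Real.exp (#S * m * (1 + #S * m * r ^ 3) * (∑ j, μ j * v j) ^ 3 * (#(pairs S) / 3)) := by
  obtain ⟨f, hf, hinj⟩ := exists_injOn_lt_card S
  have hs : (0 : ℝ) < #S := by exact_mod_cast hS.card_pos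
  set A : ℕ → Finset (Finset V) := fun c => {τ ∈ S.powersetCard 3 | (∑ a ∈ τ, f a) % #S = c}
  have hA : ∀ c, A c ⊆ S.powersetCard 3 := fun c => filter_subset _ _
  have hd : ∀ c, (A c : Set (Finset V)).PairwiseDisjoint pairs := by
    intro c τ hτ τ' hτ' hne
    simp only [A, mem_coe, mem_filter] at hτ hτ'
    exact disjoint_pairs_of_modEq hf hinj hτ.1 hτ'.1 hne (hτ.2.trans hτ'.2.symm)
  have hsum : ∀ g : Finset V → ℝ, ∑ τ ∈ S.powersetCard 3, g τ =
      ∑ c ∈ range #S, ∑ τ ∈ A c, g τ := fun g =>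
    (sum_fiberwise_of_maps_to (fun τ _ => mem_range.2 (Nat.mod_lt _ hS.card_pos)) g).symm
  have hjensen : ∀ s : V × V → J,
      Real.exp (m * ∑ τ ∈ S.powersetCard 3, ∏ e ∈ pairs τ, v (s e)) ≤
        ∑ c ∈ range #S, (1 / (#S : ℝ)) *
          Real.exp (#S * m * ∑ τ ∈ A c, ∏ e ∈ pairs τ, v (s e)) := by
    intro s
    have := convexOn_exp.map_sum_le (t := range #S) (w := fun _ => 1 / (#S : ℝ))
      (p := fun c => #S * m * ∑ τ ∈ A c, ∏ e ∈ pairs τ, v (s e))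
      (fun _ _ => by positivity) (by simp [hs.ne']) fun _ _ => Set.mem_univ _
    simp only [smul_eq_mul] at this
    refine le_trans (le_of_eq ?_) this
    rw [hsum, mul_sum]
    congr 1
    refine sum_congr rfl fun c _ => ?_
    field_simp
  calc _ ≤ avg (fun _ : V × V => μ) fun s => ∑ c ∈ range #S, (1 / (#S : ℝ)) *
          Real.exp (#S * m * ∑ τ ∈ A c, ∏ e ∈ pairs τ, v (s e)) :=
        avg_mono (fun _ => hμ0) hjensen
    _ ≤ ∑ c ∈ range #S, (1 / (#S : ℝ)) *
          Real.exp (#S * m * (1 + #S * m * r ^ 3) * (∑ j, μ j * v j) ^ 3 * (#(pairs S) / 3)) := by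
        rw [avg_sum]
        refine sum_le_sum fun c _ => ?_
        rw [avg_const_mul]
        refine mul_le_mul_of_nonneg_left ?_ (by positivity)
        exact avg_exp_class_le hμ0 hμ hv0 hv (by positivity) hmr (hA c) (hd c)
    _ = _ := by
        rw [sum_const, card_range, nsmul_eq_mul]
        field_simp

end Classes

section Tilt

variable {V : Type*} {m : ℕ}

/-- The tilt of the pair `e` by the `m` coordinates of the configuration `x`. -/
def tilt (u : ℝ) (x : Fin m × V → Bool) (e : V × V) : ℝ :=
  ∏ k, (1 + u * chi (fun a => x (k, a)) e)

lemma one_add_mul_chi_nonneg {u : ℝ} (hu : |u| ≤ 1) (y : V → Bool) (e : V × V) :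
    0 ≤ 1 + u * chi y e := by
  have := abs_le.1 hu
  rcases chi_eq y e with h | h <;> rw [h] <;> linarith

lemma tilt_nonneg {u : ℝ} (hu : |u| ≤ 1) (x : Fin m × V → Bool) (e : V × V) : 0 ≤ tilt u x e :=
  prod_nonneg fun _ _ => one_add_mul_chi_nonneg hu _ _

lemma one_sub_pow_le {a r : ℝ} {N : ℕ} (ha : 0 ≤ a) (hr : r = N * a) (hr2 : r ≤ 1 / 2)
    (hN : 1 ≤ N) : (1 - a) ^ N ≤ (1 + r ^ 2) * (1 - r) := by
  have hr0 : 0 ≤ r := by rw [hr]; positivity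
  have hN' : (1 : ℝ) ≤ N := by exact_mod_cast hN
  have har : a ≤ r := by rw [hr]; nlinarith
  have h1 : (1 - a) ^ N ≤ Real.exp (-r) := by
    calc (1 - a) ^ N ≤ Real.exp (-a) ^ N := by
          refine pow_le_pow_left₀ (by linarith) ?_ N
          have := Real.add_one_le_exp (-a)
          linarith
      _ = _ := by rw [← Real.exp_nat_mul, hr]; ring_nf
  refine h1.trans ?_
  have h2 := Real.quadratic_le_exp_of_nonneg hr0
  have h3 : 0 ≤ (1 + r ^ 2) * (1 - r) := mul_nonneg (by positivity) (by linarith)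
  have h4 : 1 ≤ (1 + r ^ 2) * (1 - r) * (1 + r + r ^ 2 / 2) := by
    have : (1 + r ^ 2) * (1 - r) * (1 + r + r ^ 2 / 2) - 1 =
        r ^ 2 / 2 * (1 - r - r ^ 2 - r ^ 3) := by ring
    have h5 : 0 ≤ 1 - r - r ^ 2 - r ^ 3 := by
      have h6 : r ^ 2 ≤ 1 / 4 := by nlinarith
      have h7 : r ^ 3 ≤ 1 / 8 := by nlinarith
      linarith
    have := mul_nonneg (by positivity : 0 ≤ r ^ 2 / 2) h5
    linarith
  rw [Real.exp_neg, inv_le_iff_one_le_mul₀ (Real.exp_pos _)]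
  exact h4.trans (mul_le_mul_of_nonneg_left h2 h3)

lemma one_add_pow_le {a r : ℝ} {N : ℕ} (ha : 0 ≤ a) (hr : r = N * a) (hr2 : r ≤ 1 / 2) :
    (1 + a) ^ N ≤ (1 + r ^ 2) * (1 + r) := by
  have hr0 : 0 ≤ r := by rw [hr]; positivity
  have h1 : (1 + a) ^ N ≤ Real.exp r := by
    calc (1 + a) ^ N ≤ Real.exp a ^ N := by
          refine pow_le_pow_left₀ (by linarith) ?_ N
          rw [add_comm]
          exact Real.add_one_le_exp _
      _ = _ := by rw [← Real.exp_nat_mul, hr]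
  have h2 := abs_le.1 (Real.abs_exp_sub_one_sub_id_le (x := r) (by
    rw [abs_of_nonneg hr0]; linarith))
  have h3 : 0 ≤ r ^ 3 := by positivity
  nlinarith [h2.2]

lemma tilt_pow_le {a r : ℝ} {N : ℕ} (ha : 0 ≤ a) (hr : r = N * a) (hr2 : r ≤ 1 / 2)
    (hN : 1 ≤ N) (x : Fin m × V → Bool) (e : V × V) :
    tilt (-a) x e ^ N ≤ (1 + r ^ 2) ^ m * tilt (-r) x e := by
  have hN' : (1 : ℝ) ≤ N := by exact_mod_cast hN
  have har : a ≤ r := by rw [hr]; nlinarith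
  unfold tilt
  have hm : (1 + r ^ 2) ^ m = ∏ _k : Fin m, (1 + r ^ 2) := by simp
  rw [← prod_pow, hm, ← prod_mul_distrib]
  refine prod_le_prod (fun k _ => pow_nonneg (one_add_mul_chi_nonneg ?_ _ _) _) fun k _ => ?_
  · rw [abs_neg, abs_of_nonneg ha]; linarith
  · rcases chi_eq (fun b => x (k, b)) e with h | h
    · rw [h, mul_one, mul_one, ← sub_eq_add_neg, ← sub_eq_add_neg]
      exact one_sub_pow_le ha hr hr2 hN
    · rw [h, neg_mul_neg, neg_mul_neg, mul_one, mul_one]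
      exact one_add_pow_le ha hr hr2

lemma one_sub_min_le {p a r : ℝ} {N : ℕ} (hp : 0 ≤ p) (ha : 0 ≤ a) (hr : r = N * a)
    (hr2 : r ≤ 1 / 2) (hN : 1 ≤ N) (x : Fin m × V → Bool) (e : V × V) :
    1 - min (p * tilt (-a) x e) 1 ≤
      1 - p * tilt (-a) x e + p ^ N * (1 + r ^ 2) ^ m * tilt (-r) x e := by
  have hr0 : 0 ≤ r := by rw [hr]; positivity
  rcases le_total (p * tilt (-a) x e) 1 with h | h
  · rw [min_eq_left h]
    have := tilt_nonneg (u := -r) (by rw [abs_neg, abs_of_nonneg hr0]; linarith) x e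
    have : 0 ≤ p ^ N * (1 + r ^ 2) ^ m * tilt (-r) x e := by positivity
    linarith
  · rw [min_eq_right h]
    have h1 : p * tilt (-a) x e ≤ (p * tilt (-a) x e) ^ N := le_self_pow₀ h (by omega)
    have h2 : (p * tilt (-a) x e) ^ N ≤ p ^ N * ((1 + r ^ 2) ^ m * tilt (-r) x e) := by
      rw [mul_pow]
      exact mul_le_mul_of_nonneg_left (tilt_pow_le ha hr hr2 hN x e) (by positivity)
    linarith

lemma dom_tilt_sub_one {u : ℝ} (hu : 0 ≤ u) (e : V × V) :
    Dom (fun x : Fin m × V → Bool => tilt (-u) x e - 1) (fun x => tilt u x e - 1) := by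
  have hmem : ∀ k : Fin m, (fun x : Fin m × V → Bool => u * chi (fun a => x (k, a)) e) ∈
      posCone (Fin m × V) := fun k =>
    mul_mem (const_mem_posCone hu) (mul_mem (sgn_mem_posCone (k, e.1)) (sgn_mem_posCone (k, e.2)))
  have := Dom.prod_sub_one (s := univ)
    (f := fun k (x : Fin m × V → Bool) => 1 + -u * chi (fun a => x (k, a)) e)
    (f' := fun k x => 1 + u * chi (fun a => x (k, a)) e) fun k _ => by
      convert (Dom.of_mem (hmem k)).neg using 1
      · funext x; simp
      · funext x; simp
  convert this using 1
  · funext x; simp [tilt]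
  · funext x; simp [tilt]

/-- Sign changes in the tilts can only increase expectations of products. -/
lemma dom_nonedge {p q a r : ℝ} (hp : 0 ≤ p) (hq : 0 ≤ q) (hpq : 0 ≤ 1 - p + q) (ha : 0 ≤ a)
    (hr : 0 ≤ r) (e : V × V) :
    Dom (fun x : Fin m × V → Bool => 1 - p * tilt (-a) x e + q * tilt (-r) x e)
      (fun x => (1 - 2 * p) + p * tilt a x e + q * tilt r x e) := by
  have h1 := Dom.of_mem (const_mem_posCone (ι := Fin m × V) hpq)
  have h2 := ((Dom.of_mem (const_mem_posCone (ι := Fin m × V) hp)).mul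
    (dom_tilt_sub_one ha e)).neg
  have h3 := (Dom.of_mem (const_mem_posCone (ι := Fin m × V) hq)).mul (dom_tilt_sub_one hr e)
  convert (h1.add h2).add h3 using 1
  · funext x; simp; ring
  · funext x; simp; ring

variable [Fintype V] [LinearOrder V]

lemma expect_prod_tilt (P : Finset (V × V)) (v : V × V → ℝ) (m : ℕ) :
    𝔼 x : Fin m × V → Bool, ∏ e ∈ P, tilt (v e) x e = part P v ^ m :=
  expect_prod_prod_chi P v m

/-- The probability that `S` spans a clique. -/
lemma expect_clique_le {S : Finset V} (hS : S.Nonempty) {p a : ℝ} (hp : 0 ≤ p) (ha : 0 ≤ a)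
    (hSa : 2 * #S * a ≤ 1) (m : ℕ) :
    𝔼 x : Fin m × V → Bool, ∏ e ∈ pairs S, min (p * tilt (-a) x e) 1 ≤
      p ^ #(pairs S) *
        Real.exp (m * (-a ^ 3 * (#S).choose 3 + 32 * (#S * a) ^ 4)) := by
  have hs : (1 : ℝ) ≤ #S := by exact_mod_cast hS.card_pos
  have ha1 : a ≤ 1 := by nlinarith
  have htilt : ∀ (x : Fin m × V → Bool) e, 0 ≤ tilt (-a) x e :=
    tilt_nonneg (by rwa [abs_neg, abs_of_nonneg ha])
  calc _ ≤ 𝔼 x : Fin m × V → Bool, ∏ e ∈ pairs S, (p * tilt (-a) x e) := by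
        refine expect_le_expect fun x _ => prod_le_prod (fun e _ => ?_) fun e _ => min_le_left _ _
        exact le_min (mul_nonneg hp (htilt x e)) zero_le_one
    _ = p ^ #(pairs S) * part (pairs S) (fun _ => -a) ^ m := by
        rw [← expect_prod_tilt, mul_expect]
        simp [prod_mul_distrib]
    _ ≤ _ := by
        refine mul_le_mul_of_nonneg_left ?_ (by positivity)
        refine (part_le_exp hS (r := a) (fun e _ => by rw [abs_neg, abs_of_nonneg ha]) ha hSa
          m).trans (le_of_eq ?_)
        rw [sum_congr rfl fun τ hτ => by
          rw [prod_const, card_pairs_of_card_eq_three (mem_powersetCard.1 hτ).2]]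
        rw [sum_const, card_powersetCard, nsmul_eq_mul]
        congr 3
        ring

/-- The probability that `S` spans an independent set. -/
lemma expect_indep_le {S : Finset V} (hS : S.Nonempty) {p a r : ℝ} {N : ℕ} (hp : 0 ≤ p)
    (hp2 : p ≤ 1 / 2) (ha : 0 ≤ a) (hr : r = N * a) (hN : 1 ≤ N) (hSr : 2 * #S * r ≤ 1)
    {m : ℕ} (hm : #S * m * r ^ 3 ≤ 1) {q W : ℝ} (hq : q = p ^ N * (1 + r ^ 2) ^ m)
    (hW : W = 1 - p + q) :
    𝔼 x : Fin m × V → Bool, ∏ e ∈ pairs S, (1 - min (p * tilt (-a) x e) 1) ≤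
      W ^ #(pairs S) * (Real.exp (m * (32 * (#S * r) ^ 4)) *
        Real.exp (#S * m * (1 + #S * m * r ^ 3) * ((p * a + q * r) / W) ^ 3 *
          (#(pairs S) / 3))) := by
  have hs : (1 : ℝ) ≤ #S := by exact_mod_cast hS.card_pos
  have hN' : (1 : ℝ) ≤ N := by exact_mod_cast hN
  have har : a ≤ r := by rw [hr]; nlinarith
  have hr0 : 0 ≤ r := ha.trans har
  have hr2 : r ≤ 1 / 2 := by nlinarith
  have hq0 : 0 ≤ q := by rw [hq]; positivity
  have hW0 : 0 < W := by linarith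
  set μ : Fin 3 → ℝ := ![(1 - 2 * p) / W, p / W, q / W] with hμdef
  set v : Fin 3 → ℝ := ![0, a, r] with hvdef
  have hμ0 : ∀ j, 0 ≤ μ j := by
    intro j
    fin_cases j
    · exact div_nonneg (by linarith) hW0.le
    · exact div_nonneg hp hW0.le
    · exact div_nonneg hq0 hW0.le
  have hμ : ∑ j, μ j = 1 := by
    simp only [hμdef, Fin.sum_univ_three, Matrix.cons_val]
    rw [← add_div, ← add_div, div_eq_one_iff_eq hW0.ne']
    linarith
  have hv0 : ∀ j, 0 ≤ v j := by
    intro j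
    fin_cases j
    · exact le_rfl
    · exact ha
    · exact hr0
  have hv : ∀ j, v j ≤ r := by
    intro j
    fin_cases j
    · exact hr0
    · exact har
    · exact le_rfl
  have hmean : ∑ j, μ j * v j = (p * a + q * r) / W := by
    simp only [hμdef, hvdef, Fin.sum_univ_three, Matrix.cons_val]
    ring
  have hmix : ∀ (x : Fin m × V → Bool) e,
      (1 - 2 * p) + p * tilt a x e + q * tilt r x e = W * ∑ j, μ j * tilt (v j) x e := by
    intro x e
    have h0 : tilt 0 x e = 1 := by simp [tilt]
    simp only [hμdef, hvdef, Fin.sum_univ_three, Matrix.cons_val, h0]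
    field_simp
  calc _ ≤ 𝔼 x : Fin m × V → Bool,
          ∏ e ∈ pairs S, (1 - p * tilt (-a) x e + q * tilt (-r) x e) := by
        refine expect_le_expect fun x _ => prod_le_prod (fun e _ => ?_) fun e _ => ?_
        · linarith [min_le_right (p * tilt (-a) x e) 1]
        · rw [hq]
          exact one_sub_min_le hp ha hr hr2 hN x e
    _ ≤ 𝔼 x : Fin m × V → Bool,
          ∏ e ∈ pairs S, ((1 - 2 * p) + p * tilt a x e + q * tilt r x e) := by
        have := (Dom.prod (s := pairs S) fun e _ =>
          dom_nonedge (m := m) hp hq0 (by linarith) ha hr0 e).expect_le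
        simpa only [prod_apply] using this
    _ = W ^ #(pairs S) *
        avg (fun _ : V × V => μ) fun s => part (pairs S) (fun e => v (s e)) ^ m := by
        simp_rw [hmix, prod_mul_distrib, prod_const, ← mul_expect, ← expect_prod_tilt]
        congr 1
        simp_rw [avg, mul_expect]
        rw [← expect_sum_comm]
        refine expect_congr rfl fun x _ => ?_
        exact (avg_prod (fun _ => hμ) (pairs S) fun e j => tilt (v j) x e).symm
    _ ≤ W ^ #(pairs S) * avg (fun _ : V × V => μ) fun s =>
          Real.exp (m * (32 * (#S * r) ^ 4)) *
            Real.exp (m * ∑ τ ∈ S.powersetCard 3, ∏ e ∈ pairs τ, v (s e)) := by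
        refine mul_le_mul_of_nonneg_left (avg_mono (fun _ => hμ0) fun s => ?_) (by positivity)
        refine (part_le_exp hS (r := r) (fun e _ => ?_) hr0 hSr m).trans (le_of_eq ?_)
        · rw [abs_of_nonneg (hv0 _)]; exact hv _
        · rw [← Real.exp_add]
          congr 1
          ring
    _ ≤ _ := by
        rw [avg_const_mul, ← hmean]
        gcongr
        exact avg_exp_triangles_le hμ0 hμ hv0 hv hS (Nat.cast_nonneg m) hm

end Tilt

section Existence

variable {V : Type*} [LinearOrder V]

lemma card_pairs (S : Finset V) : #(pairs S) = (#S).choose 2 := by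
  have h1 := two_mul_card_pairs S
  have h2 := Nat.cast_choose_two ℝ #S
  have h3 : (#(pairs S) : ℝ) = ((#S).choose 2 : ℕ) := by linarith
  exact_mod_cast h3

/-- The graph whose edges are the increasing pairs selected by `s`. -/
def graphOf (s : V × V → Bool) : SimpleGraph V :=
  SimpleGraph.fromRel fun a b => a < b ∧ s (a, b) = true

lemma graphOf_adj {s : V × V → Bool} {a b : V} (h : a < b) :
    (graphOf s).Adj a b ↔ s (a, b) = true := by
  simp [graphOf, h, h.ne, h.asymm]

lemma cliqueFree_of_forall {G : SimpleGraph V} {ℓ : ℕ}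
    (h : ∀ S : Finset V, #S = ℓ → ∃ e ∈ pairs S, ¬G.Adj e.1 e.2) : G.CliqueFree ℓ := by
  intro S hS
  obtain ⟨e, he, hadj⟩ := h S hS.card_eq
  obtain ⟨h1, h2, h3⟩ := mem_pairs.1 he
  exact hadj (hS.isClique h1 h2 h3.ne)

variable [Fintype V]

lemma exists_graph_of_sum_lt_one {w : V × V → ℝ} (hw0 : ∀ e, 0 ≤ w e) (hw1 : ∀ e, w e ≤ 1)
    {ℓ t : ℕ} (h : ∑ S ∈ univ.powersetCard ℓ, ∏ e ∈ pairs S, w e +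
      ∑ T ∈ univ.powersetCard t, ∏ e ∈ pairs T, (1 - w e) < 1) :
    ∃ G : SimpleGraph V, G.CliqueFree ℓ ∧ Gᶜ.CliqueFree t := by
  set μ : V × V → Bool → ℝ := fun e b => if b then w e else 1 - w e with hμdef
  have hμ0 : ∀ e b, 0 ≤ μ e b := by
    rintro e (_ | _)
    · simpa [μ] using hw1 e
    · simpa [μ] using hw0 e
  have hμ : ∀ e, ∑ b, μ e b = 1 := fun e => by simp [μ]
  set X : (V × V → Bool) → ℝ := fun s => ∑ S ∈ univ.powersetCard ℓ, ∏ e ∈ pairs S,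
    (if s e then 1 else 0) with hX
  set Y : (V × V → Bool) → ℝ := fun s => ∑ T ∈ univ.powersetCard t, ∏ e ∈ pairs T,
    (if s e then 0 else 1) with hY
  have hXavg : avg μ X = ∑ S ∈ univ.powersetCard ℓ, ∏ e ∈ pairs S, w e := by
    rw [hX, avg_sum]
    refine sum_congr rfl fun S _ => ?_
    rw [avg_prod hμ (pairs S) fun _ b => if b then 1 else 0]
    simp [μ]
  have hYavg : avg μ Y = ∑ T ∈ univ.powersetCard t, ∏ e ∈ pairs T, (1 - w e) := by
    rw [hY, avg_sum]
    refine sum_congr rfl fun S _ => ?_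
    rw [avg_prod hμ (pairs S) fun _ b => if b then 0 else 1]
    simp [μ]
  obtain ⟨s, hs⟩ : ∃ s, X s + Y s < 1 := by
    by_contra! hcon
    have h1 := avg_mono hμ0 hcon
    rw [avg_const hμ] at h1
    have h2 : avg μ (fun s => X s + Y s) = avg μ X + avg μ Y := by
      simp only [avg, mul_add, sum_add_distrib]
    rw [h2, hXavg, hYavg] at h1
    linarith
  have hX0 : 0 ≤ X s := sum_nonneg fun S _ => prod_nonneg fun e _ => by split_ifs <;> norm_num
  have hY0 : 0 ≤ Y s := sum_nonneg fun S _ => prod_nonneg fun e _ => by split_ifs <;> norm_num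
  refine ⟨graphOf s, cliqueFree_of_forall fun S hS => ?_, cliqueFree_of_forall fun T hT => ?_⟩
  · by_contra! hcon
    have h1 : ∏ e ∈ pairs S, (if s e then (1 : ℝ) else 0) = 1 := prod_eq_one fun e he => by
      rw [if_pos ((graphOf_adj (mem_pairs.1 he).2.2).1 (hcon e he))]
    have h2 : ∏ e ∈ pairs S, (if s e then (1 : ℝ) else 0) ≤ X s :=
      single_le_sum (f := fun S => ∏ e ∈ pairs S, (if s e then (1 : ℝ) else 0))
        (fun S _ => prod_nonneg fun e _ => by split_ifs <;> norm_num)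
        (mem_powersetCard.2 ⟨subset_univ S, hS⟩)
    linarith
  · by_contra! hcon
    have h1 : ∏ e ∈ pairs T, (if s e then (0 : ℝ) else 1) = 1 := prod_eq_one fun e he => by
      have h3 := (SimpleGraph.compl_adj _ _ _).1 (hcon e he)
      rw [if_neg fun h4 => h3.2 ((graphOf_adj (mem_pairs.1 he).2.2).2 h4)]
    have h2 : ∏ e ∈ pairs T, (if s e then (0 : ℝ) else 1) ≤ Y s :=
      single_le_sum (f := fun T => ∏ e ∈ pairs T, (if s e then (0 : ℝ) else 1))
        (fun T _ => prod_nonneg fun e _ => by split_ifs <;> norm_num)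
        (mem_powersetCard.2 ⟨subset_univ T, hT⟩)
    linarith

lemma exists_graph_of_expect_le {Ω : Type*} [Fintype Ω] [Nonempty Ω] {w : Ω → V × V → ℝ}
    (hw0 : ∀ x e, 0 ≤ w x e) (hw1 : ∀ x e, w x e ≤ 1) {ℓ t : ℕ} {A B : ℝ}
    (hA : ∀ S : Finset V, #S = ℓ → 𝔼 x, ∏ e ∈ pairs S, w x e ≤ A)
    (hB : ∀ T : Finset V, #T = t → 𝔼 x, ∏ e ∈ pairs T, (1 - w x e) ≤ B)
    (hA0 : 0 ≤ A) (hB0 : 0 ≤ B)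
    (h : (Fintype.card V : ℝ) ^ ℓ * A + (Fintype.card V : ℝ) ^ t * B < 1) :
    ∃ G : SimpleGraph V, G.CliqueFree ℓ ∧ Gᶜ.CliqueFree t := by
  have hbound : 𝔼 x, (∑ S ∈ univ.powersetCard ℓ, ∏ e ∈ pairs S, w x e +
      ∑ T ∈ univ.powersetCard t, ∏ e ∈ pairs T, (1 - w x e)) < 1 := by
    rw [expect_add_distrib, expect_sum_comm, expect_sum_comm]
    refine lt_of_le_of_lt (add_le_add ?_ ?_) h
    · refine (sum_le_sum fun S hS => hA S (mem_powersetCard.1 hS).2).trans ?_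
      rw [sum_const, card_powersetCard, nsmul_eq_mul, card_univ]
      gcongr
      exact_mod_cast Nat.choose_le_pow _ _
    · refine (sum_le_sum fun S hS => hB S (mem_powersetCard.1 hS).2).trans ?_
      rw [sum_const, card_powersetCard, nsmul_eq_mul, card_univ]
      gcongr
      exact_mod_cast Nat.choose_le_pow _ _
  obtain ⟨x, -, hx⟩ := exists_lt_of_expect_lt univ_nonempty hbound
  exact exists_graph_of_sum_lt_one (hw0 x) (hw1 x) hx

lemma exists_graph_of_params {n ℓ t m N : ℕ} (hℓ : 1 ≤ ℓ) (hℓt : ℓ ≤ t) {p a r q W : ℝ}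
    (hp : 0 ≤ p) (hp2 : p ≤ 1 / 2) (ha : 0 ≤ a) (hr : r = N * a) (hN : 1 ≤ N)
    (htr : 2 * t * r ≤ 1) (hm : t * m * r ^ 3 ≤ 1) (hq : q = p ^ N * (1 + r ^ 2) ^ m)
    (hW : W = 1 - p + q)
    (h : (n : ℝ) ^ ℓ * (p ^ ℓ.choose 2 *
        Real.exp (m * (-a ^ 3 * ℓ.choose 3 + 32 * (ℓ * a) ^ 4))) +
      (n : ℝ) ^ t * (W ^ t.choose 2 * (Real.exp (m * (32 * (t * r) ^ 4)) *
        Real.exp (t * m * (1 + t * m * r ^ 3) * ((p * a + q * r) / W) ^ 3 *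
          (t.choose 2 / 3)))) < 1) :
    ∃ G : SimpleGraph (Fin n), G.CliqueFree ℓ ∧ Gᶜ.CliqueFree t := by
  have hN' : (1 : ℝ) ≤ N := by exact_mod_cast hN
  have hℓ' : (1 : ℝ) ≤ ℓ := by exact_mod_cast hℓ
  have hℓt' : (ℓ : ℝ) ≤ t := by exact_mod_cast hℓt
  have har : a ≤ r := by rw [hr]; nlinarith
  have hta : 2 * t * a ≤ 1 := le_trans (by gcongr) htr
  have hℓa : 2 * ℓ * a ≤ 1 := le_trans (by gcongr) hta
  have ha1 : a ≤ 1 := by nlinarith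
  have hq0 : 0 ≤ q := by rw [hq]; positivity
  have hW0 : 0 ≤ W := by linarith
  refine exists_graph_of_expect_le (Ω := Fin m × Fin n → Bool)
    (w := fun x e => min (p * tilt (-a) x e) 1) (fun x e => ?_) (fun x e => min_le_right _ _)
    (fun S hS => ?_) (fun T hT => ?_) ?_ ?_ (by rw [Fintype.card_fin]; exact h)
  · exact le_min (mul_nonneg hp (tilt_nonneg (by rwa [abs_neg, abs_of_nonneg ha]) x e)) zero_le_one
  · have := expect_clique_le (S := S) (card_pos.1 (by omega)) hp ha (by rwa [hS]) m
    rwa [card_pairs, hS] at this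
  · have := expect_indep_le (S := T) (card_pos.1 (by omega)) hp hp2 ha hr hN (by rwa [hT])
      (m := m) (by rwa [hT]) hq hW
    rwa [card_pairs, hT] at this
  · positivity
  · positivity

end Existence

section Parameters

open Filter
open scoped Topology

lemma sq_mul_neg_log_lt {p : ℝ} (hp0 : 0 < p) (hp : p < 1 / 2) :
    p ^ 2 * -Real.log p < (1 - p) ^ 2 * -Real.log (1 - p) := by
  have h := Real.strictConcaveOn_negMulLog.slope_anti_adjacent (x := p) (y := 1 - p) (z := 1)
    (Set.mem_Ici.2 hp0.le) (Set.mem_Ici.2 zero_le_one) (by linarith) (by linarith)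
  rw [div_lt_div_iff₀ (by linarith) (by linarith)] at h
  simp only [Real.negMulLog, Real.log_one] at h
  nlinarith

lemma cast_choose_three (n : ℕ) : (n.choose 3 : ℝ) = n * (n - 1) * (n - 2) / 6 := by
  induction n with
  | zero => simp
  | succ n ih =>
    rw [Nat.choose_succ_succ' n 2]
    push_cast
    rw [ih, Nat.cast_choose_two]
    ring

lemma clique_exponent_le {ℓ N : ℕ} (hℓ : 1 ≤ ℓ) (hN : 1 ≤ N) {p s c a : ℝ} (hp : 0 < p)
    (hlo : -c ≤ Real.log p) (hhi : Real.log p ≤ -c + s / (3 * N ^ 7))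
    (ha : a = 1 / (N ^ 5 * ℓ)) :
    p ^ ℓ.choose 2 * Real.exp (((N ^ 8 * ℓ ^ 2 : ℕ) : ℝ) *
      (-a ^ 3 * ℓ.choose 3 + 32 * (ℓ * a) ^ 4)) ≤
      Real.exp (-(c / 2 + (1 - s - 192 / N ^ 5) / (6 * N ^ 7)) * (ℓ * ℓ) +
        (c / 2 + 1 / 2) * ℓ) := by
  have hℓ' : (1 : ℝ) ≤ ℓ := by exact_mod_cast hℓ
  have hN' : (1 : ℝ) ≤ N := by exact_mod_cast hN
  have hℓ0 : (0 : ℝ) < ℓ := by linarith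
  have hN0 : (0 : ℝ) < N := by linarith
  rw [← Real.exp_log hp, ← Real.exp_nat_mul, ← Real.exp_add, Real.exp_le_exp,
    Nat.cast_choose_two, cast_choose_three]
  have h1 : ((N ^ 8 * ℓ ^ 2 : ℕ) : ℝ) *
      (-a ^ 3 * (ℓ * (ℓ - 1) * (ℓ - 2) / 6) + 32 * (ℓ * a) ^ 4) =
      -(((ℓ : ℝ) - 1) * (ℓ - 2) / (6 * N ^ 7)) + 32 * ℓ ^ 2 / N ^ 12 := by
    rw [ha]
    push_cast
    field_simp
  have hc : -c / 2 ≤ Real.log p / 2 := by linarith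
  have hG : 1 / (N : ℝ) ^ 7 ≤ 1 := by
    rw [div_le_one (by positivity)]; exact one_le_pow₀ hN'
  rw [h1]
  have h2 : (ℓ : ℝ) * (ℓ - 1) / 2 * Real.log p ≤
      ℓ ^ 2 / 2 * (-c + s / (3 * N ^ 7)) + ℓ * (c / 2) := by
    have h3 : (ℓ : ℝ) ^ 2 / 2 * Real.log p ≤ ℓ ^ 2 / 2 * (-c + s / (3 * N ^ 7)) := by gcongr
    nlinarith
  have h4 : -(((ℓ : ℝ) - 1) * (ℓ - 2) / (6 * N ^ 7)) ≤
      -(ℓ * ℓ / (6 * N ^ 7)) + ℓ * (1 / 2) * (1 / (N : ℝ) ^ 7) := by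
    have h5 : -(((ℓ : ℝ) - 1) * (ℓ - 2) / (6 * N ^ 7)) =
        -(ℓ * ℓ / (6 * N ^ 7)) + ℓ * (1 / 2) * (1 / (N : ℝ) ^ 7) - 1 / (3 * N ^ 7) := by
      field_simp
      ring
    have h6 : 0 ≤ 1 / (3 * (N : ℝ) ^ 7) := by positivity
    linarith
  have h7 : (ℓ : ℝ) * (1 / 2) * (1 / (N : ℝ) ^ 7) ≤ ℓ * (1 / 2) * 1 := by gcongr
  have h8 : -(c / 2 + (1 - s - 192 / N ^ 5) / (6 * N ^ 7)) * ((ℓ : ℝ) * ℓ) +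
      (c / 2 + 1 / 2) * ℓ = ℓ ^ 2 / 2 * (-c + s / (3 * N ^ 7)) + ℓ * (c / 2) +
        (-(ℓ * ℓ / (6 * N ^ 7)) + ℓ * (1 / 2) * 1 + 32 * ℓ ^ 2 / N ^ 12) := by
    field_simp
    ring
  linarith

/-- The gain in the independent set exponent, in units of `1 / (6 * N ^ 7)`. -/
noncomputable def gain (C p₀ s : ℝ) (N : ℕ) : ℝ :=
  s * (p₀ / (1 - p₀)) - 9 * (N ^ 7 * (1 / 2) ^ N) / (1 - p₀) - 192 * (C + 1) ^ 2 / N -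
    C * ((1 + (C + 1) / N ^ 4) * ((p₀ * (1 + s / (3 * N ^ 7)) + 3 * (N * (1 / 2) ^ N)) /
      (1 - p₀ * (1 + s / (3 * N ^ 7)))) ^ 3)

lemma tendsto_const_div_pow (c : ℝ) {k : ℕ} (hk : k ≠ 0) :
    Tendsto (fun N : ℕ => c / (N : ℝ) ^ k) atTop (𝓝 0) :=
  ((tendsto_pow_atTop hk).comp tendsto_natCast_atTop_atTop).const_div_atTop c

lemma tendsto_density (p₀ s : ℝ) :
    Tendsto (fun N : ℕ => p₀ * (1 + s / (3 * (N : ℝ) ^ 7))) atTop (𝓝 p₀) := by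
  have h := (((tendsto_const_div_pow (s / 3) (k := 7) (by norm_num)).const_add 1).const_mul p₀)
  simp only [add_zero, mul_one, div_div] at h
  exact h

lemma tendsto_gain {C p₀ s : ℝ} (hp : p₀ < 1 / 2) :
    Tendsto (gain C p₀ s) atTop (𝓝 (s * (p₀ / (1 - p₀)) - C * (p₀ / (1 - p₀)) ^ 3)) := by
  have h1 : Tendsto (fun N : ℕ => (N : ℝ) ^ 7 * (1 / 2 : ℝ) ^ N) atTop (𝓝 0) :=
    tendsto_pow_const_mul_const_pow_of_abs_lt_one 7 (by norm_num [abs_of_pos])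
  have h2 : Tendsto (fun N : ℕ => (N : ℝ) * (1 / 2 : ℝ) ^ N) atTop (𝓝 0) := by
    simpa using tendsto_pow_const_mul_const_pow_of_abs_lt_one 1
      (r := (1 / 2 : ℝ)) (by norm_num [abs_of_pos])
  have h3 := tendsto_const_div_pow (192 * (C + 1) ^ 2) (k := 1) one_ne_zero
  have h4 := tendsto_const_div_pow (C + 1) (k := 4) (by norm_num)
  have h5 := tendsto_density p₀ s
  have h6 := ((tendsto_const_nhds (x := s * (p₀ / (1 - p₀)))).sub
    ((h1.const_mul 9).div_const (1 - p₀))).sub h3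
  have h7 := ((h5.add (h2.const_mul 3)).div (h5.const_sub 1) (by linarith)).pow 3
  have h8 := h6.sub (((h4.const_add 1).mul h7).const_mul C)
  convert h8 using 1
  · funext N
    simp [gain]
  · simp

lemma one_add_pow_le_three {x : ℝ} {k : ℕ} (hx : 0 ≤ x) (h : k * x ≤ 1) : (1 + x) ^ k ≤ 3 := by
  calc (1 + x) ^ k ≤ Real.exp x ^ k := by
        gcongr
        rw [add_comm]
        exact Real.add_one_le_exp x
    _ = Real.exp (k * x) := (Real.exp_nat_mul x k).symm
    _ ≤ Real.exp 1 := Real.exp_le_exp.2 h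
    _ ≤ 3 := by linarith [Real.exp_one_lt_d9]

lemma choose_two_mul_log_le {t N : ℕ} (ht : (1 : ℝ) ≤ t) {p₀ s p q W : ℝ} (hp₀ : 0 < 1 - p₀)
    (hp : p = p₀ * (1 + s / (3 * N ^ 7))) (hp2 : p ≤ 1 / 2) (hq0 : 0 ≤ q)
    (hqle : q ≤ 3 * (1 / 2) ^ N) (hW : W = 1 - p + q) :
    (t.choose 2 : ℝ) * Real.log W ≤
      t ^ 2 / 2 * (Real.log (1 - p₀) +
        (3 * (1 / 2) ^ N - p₀ * (s / (3 * N ^ 7))) / (1 - p₀)) + t / 2 := by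
  have hW2 : 1 / 2 ≤ W := by linarith
  have hW0 : 0 < W := by linarith
  have hlogW : -1 ≤ Real.log W := by
    have h1 : Real.log (1 / 2) ≤ Real.log W := Real.log_le_log (by norm_num) hW2
    rw [one_div, Real.log_inv] at h1
    linarith [Real.log_two_lt_d9]
  have hlog : Real.log W ≤
      Real.log (1 - p₀) + (3 * (1 / 2) ^ N - p₀ * (s / (3 * N ^ 7))) / (1 - p₀) := by
    have h1 : Real.log W = Real.log (1 - p₀) + Real.log (W / (1 - p₀)) := by
      rw [Real.log_div hW0.ne' hp₀.ne']; ring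
    have h2 := Real.log_le_sub_one_of_pos (div_pos hW0 hp₀)
    have h3 : W / (1 - p₀) - 1 ≤ (3 * (1 / 2) ^ N - p₀ * (s / (3 * N ^ 7))) / (1 - p₀) := by
      rw [div_sub_one hp₀.ne', div_le_div_iff_of_pos_right hp₀, hW, hp]
      linarith
    linarith
  rw [Nat.cast_choose_two]
  have h1 := mul_le_mul_of_nonneg_left hlog (by positivity : 0 ≤ (t : ℝ) ^ 2 / 2)
  nlinarith

lemma indep_quartic_le {ℓ t N : ℕ} (hℓ0 : (0 : ℝ) < ℓ) (hN0 : (0 : ℝ) < N) {C a r : ℝ}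
    (htℓ : (t : ℝ) ≤ (C + 1) * ℓ) (ha : a = 1 / (N ^ 5 * ℓ)) (hr : r = N * a) :
    ((N ^ 8 * ℓ ^ 2 : ℕ) : ℝ) * (32 * (t * r) ^ 4) ≤ 32 * (C + 1) ^ 2 / N ^ 8 * t ^ 2 := by
  have hsq : (t : ℝ) ^ 2 ≤ ((C + 1) * ℓ) ^ 2 := pow_le_pow_left₀ (Nat.cast_nonneg t) htℓ 2
  have h1 : ((N ^ 8 * ℓ ^ 2 : ℕ) : ℝ) * (32 * (t * r) ^ 4) =
      32 / (N ^ 8 * ℓ ^ 2) * t ^ 2 * t ^ 2 := by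
    rw [hr, ha]
    push_cast
    field_simp
  have h2 : 32 * (C + 1) ^ 2 / N ^ 8 * (t : ℝ) ^ 2 =
      32 / (N ^ 8 * ℓ ^ 2) * ((C + 1) * ℓ) ^ 2 * t ^ 2 := by
    field_simp
  rw [h1, h2]
  exact mul_le_mul_of_nonneg_right (mul_le_mul_of_nonneg_left hsq (by positivity)) (by positivity)

lemma mul_mul_cube_le {ℓ t N : ℕ} (hℓ0 : (0 : ℝ) < ℓ) (hN0 : (0 : ℝ) < N) {C a r : ℝ}
    (htℓ : (t : ℝ) ≤ (C + 1) * ℓ) (ha : a = 1 / (N ^ 5 * ℓ)) (hr : r = N * a) :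
    t * ((N ^ 8 * ℓ ^ 2 : ℕ) : ℝ) * r ^ 3 ≤ (C + 1) / N ^ 4 := by
  have h1 : t * ((N ^ 8 * ℓ ^ 2 : ℕ) : ℝ) * r ^ 3 = t / (N ^ 4 * ℓ) := by
    rw [hr, ha]
    push_cast
    field_simp
  have h2 : (C + 1) / (N : ℝ) ^ 4 = (C + 1) * ℓ / (N ^ 4 * ℓ) := by field_simp
  rw [h1, h2]
  gcongr

lemma indep_cubic_le {ℓ t N : ℕ} (hℓ0 : (0 : ℝ) < ℓ) (hN0 : (0 : ℝ) < N) {C a r Q v : ℝ}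
    (hC : 0 ≤ C + 1) (ht0 : (0 : ℝ) ≤ t - 1) (ht : (t : ℝ) ≤ C * ℓ + 1)
    (htℓ : (t : ℝ) ≤ (C + 1) * ℓ) (ha : a = 1 / (N ^ 5 * ℓ))
    (hr : r = N * a) (hQ : 0 ≤ Q) (hv0 : 0 ≤ v) (hv : v ≤ a * Q) :
    t * ((N ^ 8 * ℓ ^ 2 : ℕ) : ℝ) * (1 + t * ((N ^ 8 * ℓ ^ 2 : ℕ) : ℝ) * r ^ 3) * v ^ 3 *
      (t.choose 2 / 3) ≤
      (C * t ^ 2 + (C + 1) * t) * ((1 + (C + 1) / N ^ 4) * Q ^ 3) / (6 * N ^ 7) := by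
  have hmr := mul_mul_cube_le hℓ0 hN0 htℓ ha hr
  have ha0 : 0 ≤ a := by rw [ha]; positivity
  have hr0 : 0 ≤ r := by rw [hr]; positivity
  have hc : (t.choose 2 : ℝ) ≤ t ^ 2 / 2 := by rw [Nat.cast_choose_two]; nlinarith
  calc _ ≤ t * ((N ^ 8 * ℓ ^ 2 : ℕ) : ℝ) * (1 + (C + 1) / N ^ 4) * (a * Q) ^ 3 *
        (t ^ 2 / 2 / 3) := by gcongr
    _ = (t ^ 3 / ℓ) * ((1 + (C + 1) / N ^ 4) * Q ^ 3) / (6 * N ^ 7) := by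
        generalize (1 + (C + 1) / (N : ℝ) ^ 4) = R
        rw [ha]
        push_cast
        field_simp
        ring
    _ ≤ _ := by
        have h1 : (t : ℝ) ^ 3 / ℓ ≤ C * t ^ 2 + (C + 1) * t := by
          rw [div_le_iff₀ hℓ0]
          nlinarith [mul_le_mul_of_nonneg_left ht (by positivity : 0 ≤ (t : ℝ) ^ 2),
            mul_le_mul_of_nonneg_left htℓ (by positivity : 0 ≤ (t : ℝ))]
        gcongr

lemma indep_exponent_eq {N C p₀ s R g x : ℝ} (hN : N ≠ 0) (hp : 1 - p₀ ≠ 0)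
    (hg : g = s * (p₀ / (1 - p₀)) - 9 * (N ^ 7 * x) / (1 - p₀) - 192 * (C + 1) ^ 2 / N - C * R)
    (b t : ℝ) :
    t ^ 2 / 2 * (b + (3 * x - p₀ * (s / (3 * N ^ 7))) / (1 - p₀)) + t / 2 +
      (32 * (C + 1) ^ 2 / N ^ 8 * t ^ 2 + (C * t ^ 2 + (C + 1) * t) * R / (6 * N ^ 7)) =
      -(-b / 2 + g / (6 * N ^ 7)) * t ^ 2 + (1 / 2 + (C + 1) * R / (6 * N ^ 7)) * t := by
  rw [hg]
  field_simp
  ring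

lemma mul_add_mul_le_sq {C b g ℓ t : ℝ} (hC : 1 ≤ C) (hg : 0 ≤ g) (hb : 0 ≤ b) (hℓ : 0 ≤ ℓ)
    (ht : C * ℓ ≤ t) : (C * b / 2 + g) * (ℓ * t) ≤ (b / 2 + g) * t ^ 2 := by
  have ht0 : 0 ≤ t := (by positivity : 0 ≤ C * ℓ).trans ht
  have h1 : C * b / 2 + g ≤ (b / 2 + g) * C := by
    linarith [le_mul_of_one_le_right hg hC]
  calc _ ≤ (b / 2 + g) * C * (ℓ * t) := by gcongr
    _ = (b / 2 + g) * (C * ℓ * t) := by ring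
    _ ≤ (b / 2 + g) * (t * t) := by gcongr
    _ = _ := by rw [sq]

lemma indep_exponent_le {ℓ t N : ℕ} (hℓ : 1 ≤ ℓ) (hN : 1 ≤ N) {C p₀ s p a r q W b : ℝ}
    (hC : 1 ≤ C) (hs : 0 ≤ s) (hs1 : s ≤ 1) (hp₀ : 0 < p₀)
    (hp : p = p₀ * (1 + s / (3 * N ^ 7)))
    (hp2 : p ≤ 1 / 2) (ha : a = 1 / (N ^ 5 * ℓ)) (hr : r = N * a)
    (hq : q = p ^ N * (1 + r ^ 2) ^ (N ^ 8 * ℓ ^ 2)) (hW : W = 1 - p + q)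
    (hb : b = -Real.log (1 - p₀)) (ht : C * ℓ ≤ t) (ht' : (t : ℝ) ≤ C * ℓ + 1)
    (hgain : 0 ≤ gain C p₀ s N) :
    W ^ t.choose 2 * (Real.exp (((N ^ 8 * ℓ ^ 2 : ℕ) : ℝ) * (32 * (t * r) ^ 4)) *
      Real.exp (t * ((N ^ 8 * ℓ ^ 2 : ℕ) : ℝ) * (1 + t * ((N ^ 8 * ℓ ^ 2 : ℕ) : ℝ) * r ^ 3) *
        ((p * a + q * r) / W) ^ 3 * (t.choose 2 / 3))) ≤
      Real.exp (-(C * b / 2 + gain C p₀ s N / (6 * N ^ 7)) * (ℓ * t) + (C + 1) * t) := by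
  have hℓ' : (1 : ℝ) ≤ ℓ := by exact_mod_cast hℓ
  have hN' : (1 : ℝ) ≤ N := by exact_mod_cast hN
  have hℓ0 : (0 : ℝ) < ℓ := by linarith
  have hN0 : (0 : ℝ) < N := by linarith
  have htℓ : (t : ℝ) ≤ (C + 1) * ℓ := by nlinarith
  have ht1 : (1 : ℝ) ≤ t := by nlinarith
  have hp₀p : p₀ ≤ p := by
    rw [hp]
    exact le_mul_of_one_le_right hp₀.le (le_add_of_nonneg_right (by positivity))
  have hp0 : 0 < p := by linarith
  have ha0 : 0 ≤ a := by rw [ha]; positivity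
  have hr0 : 0 ≤ r := by rw [hr]; positivity
  have hq0 : 0 ≤ q := by rw [hq]; positivity
  have hqle : q ≤ 3 * (1 / 2) ^ N := by
    have h1 : (1 + r ^ 2) ^ (N ^ 8 * ℓ ^ 2) ≤ 3 := by
      refine one_add_pow_le_three (by positivity) (le_of_eq ?_)
      rw [hr, ha]
      push_cast
      field_simp
    rw [hq, mul_comm]
    gcongr
  have hb0 : 0 ≤ b := by
    rw [hb]
    have := Real.log_nonpos (x := 1 - p₀) (by linarith) (by linarith)
    linarith
  have hW2 : 1 / 2 ≤ W := by linarith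
  have hW0 : 0 < W := by linarith
  set Q : ℝ := (p + 3 * (N * (1 / 2) ^ N)) / (1 - p) with hQ
  set R : ℝ := (1 + (C + 1) / N ^ 4) * Q ^ 3 with hR
  have hQ0 : 0 ≤ Q := div_nonneg (by positivity) (by linarith)
  have hR0 : 0 ≤ R := by positivity
  have hgain_eq : gain C p₀ s N = s * (p₀ / (1 - p₀)) -
      9 * (N ^ 7 * (1 / 2) ^ N) / (1 - p₀) - 192 * (C + 1) ^ 2 / N - C * R := by
    rw [hR, hQ, hp, gain]
  have hp₀1 : 0 < 1 - p₀ := by linarith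
  have hR1 : R ≤ 1 := by
    have h1 : 0 ≤ 9 * (N ^ 7 * (1 / 2 : ℝ) ^ N) / (1 - p₀) := by positivity
    have h2 : 0 ≤ 192 * (C + 1) ^ 2 / (N : ℝ) := by positivity
    have h3 : p₀ / (1 - p₀) ≤ 1 := by rw [div_le_one hp₀1]; linarith
    have h4 : s * (p₀ / (1 - p₀)) ≤ 1 * 1 := by gcongr
    nlinarith
  have hv : (p * a + q * r) / W ≤ a * Q := by
    have h1 : p * a + q * r ≤ a * (p + 3 * (N * (1 / 2) ^ N)) := by
      rw [hr]
      have : q * (N * a) ≤ 3 * (1 / 2) ^ N * (N * a) := by gcongr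
      linarith
    calc _ ≤ a * (p + 3 * (N * (1 / 2) ^ N)) / (1 - p) :=
          div_le_div₀ (by positivity) h1 (by linarith) (by linarith)
      _ = a * Q := by rw [hQ]; ring
  have hv0 : 0 ≤ (p * a + q * r) / W := by positivity
  have hfirst := choose_two_mul_log_le ht1 hp₀1 hp hp2 hq0 hqle hW
  have hsecond := indep_quartic_le hℓ0 hN0 htℓ ha hr
  have hthird := indep_cubic_le hℓ0 hN0 (by positivity) (by linarith) ht' htℓ ha hr hQ0 hv0 hv
  rw [← hR] at hthird
  rw [← Real.exp_log hW0, ← Real.exp_nat_mul, ← Real.exp_add, ← Real.exp_add,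
    Real.exp_le_exp, Real.exp_log hW0]
  have hlin : 1 / 2 + (C + 1) * R / (6 * N ^ 7) ≤ C + 1 := by
    have h1 : (C + 1) * R / (6 * N ^ 7) ≤ (C + 1) * 1 / (6 * 1) := by
      gcongr
      exact one_le_pow₀ hN'
    linarith
  have hquad := mul_add_mul_le_sq (t := (t : ℝ)) hC
    (by positivity : 0 ≤ gain C p₀ s N / (6 * N ^ 7)) hb0 hℓ0.le ht
  have htotal := indep_exponent_eq hN0.ne' hp₀1.ne' hgain_eq (Real.log (1 - p₀)) t
  rw [← hb] at htotal
  have hlin2 := mul_le_mul_of_nonneg_right hlin (by positivity : 0 ≤ (t : ℝ))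
  refine (add_le_add hfirst (add_le_add hsecond hthird)).trans ?_
  rw [htotal]
  linarith

end Parameters

section Main

open Filter

lemma exists_tilt_scale {C p₀ : ℝ} (hp₀ : 0 < p₀) (hp₀2 : p₀ < 1 / 2)
    (hlog : Real.log p₀ = C * Real.log (1 - p₀)) :
    ∃ s : ℝ, ∃ N : ℕ, 0 ≤ s ∧ s ≤ 1 ∧ 1 ≤ N ∧ 2 * ((C + 1) / (N : ℝ) ^ 4) ≤ 1 ∧
      p₀ * (1 + s / (3 * (N : ℝ) ^ 7)) ≤ 1 / 2 ∧ 0 < 1 - s - 192 / (N : ℝ) ^ 5 ∧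
      0 < gain C p₀ s N := by
  have hp₀1 : 0 < 1 - p₀ := by linarith
  have hb : Real.log (1 - p₀) < 0 := Real.log_neg hp₀1 (by linarith)
  have ha : Real.log p₀ < 0 := Real.log_neg hp₀ (by linarith)
  have hC : 0 < C := by
    by_contra! h
    linarith [mul_nonneg_of_nonpos_of_nonpos h hb.le]
  have hϖ : C * (p₀ / (1 - p₀)) ^ 2 < 1 := by
    rw [div_pow, ← mul_div_assoc, div_lt_one (by positivity)]
    have h := sq_mul_neg_log_lt hp₀ hp₀2
    rw [hlog] at h
    have h' : C * p₀ ^ 2 * -Real.log (1 - p₀) < (1 - p₀) ^ 2 * -Real.log (1 - p₀) := by linarith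
    exact lt_of_mul_lt_mul_right h' (by linarith)
  have hϖ0 : 0 < p₀ / (1 - p₀) := by positivity
  obtain ⟨s, hs0, hs1⟩ := exists_between hϖ
  have hs : 0 ≤ s := le_trans (by positivity) hs0.le
  have hgain : 0 < s * (p₀ / (1 - p₀)) - C * (p₀ / (1 - p₀)) ^ 3 := by
    linarith [mul_pos (sub_pos.2 hs0) hϖ0]
  have h1 := ((tendsto_const_div_pow (C + 1) (k := 4)
    (by norm_num)).const_mul 2).eventually_lt_const (by norm_num : (2 : ℝ) * 0 < 1)
  have h2 := (tendsto_density p₀ s).eventually_lt_const hp₀2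
  have h3 := (tendsto_const_div_pow 192 (k := 5) (by norm_num)).eventually_lt_const (sub_pos.2 hs1)
  have h4 := (tendsto_gain (C := C) (s := s) hp₀2).eventually_const_lt hgain
  obtain ⟨N, h1, h2, h3, h4, h5⟩ :=
    (h1.and (h2.and (h3.and (h4.and (eventually_ge_atTop 1))))).exists
  exact ⟨s, N, hs, hs1.le, h5, h1.le, h2.le, sub_pos.2 h3, h4⟩

/-- A union bound of this shape is below one once `ℓ` is large. -/
lemma union_bound_lt_one {n ℓ t : ℕ} {c γ δ K A B : ℝ} (hℓ : 1 ≤ ℓ) (hℓt : ℓ ≤ t)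
    (hn : (n : ℝ) ≤ Real.exp (c + δ) ^ ℓ) (hγ : K + 1 ≤ ℓ * (γ - δ))
    (hA : A ≤ Real.exp (-(c + γ) * (ℓ * ℓ) + K * ℓ))
    (hB : B ≤ Real.exp (-(c + γ) * (ℓ * t) + K * t)) :
    (n : ℝ) ^ ℓ * A + (n : ℝ) ^ t * B < 1 := by
  have key : ∀ (k : ℕ) (X : ℝ), 1 ≤ k → X ≤ Real.exp (-(c + γ) * (ℓ * k) + K * k) →
      (n : ℝ) ^ k * X ≤ Real.exp (-1) := by
    intro k X hk hX
    have hk' : (1 : ℝ) ≤ k := by exact_mod_cast hk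
    calc (n : ℝ) ^ k * X ≤ (n : ℝ) ^ k * Real.exp (-(c + γ) * (ℓ * k) + K * k) := by gcongr
      _ ≤ (Real.exp (c + δ) ^ ℓ) ^ k * Real.exp (-(c + γ) * (ℓ * k) + K * k) := by gcongr
      _ = Real.exp (-(k * (ℓ * (γ - δ) - K))) := by
          rw [← Real.exp_nat_mul, ← Real.exp_nat_mul, ← Real.exp_add]
          ring_nf
      _ ≤ Real.exp (-1) := by
          rw [Real.exp_le_exp, neg_le_neg_iff]
          exact one_le_mul_of_one_le_of_one_le hk' (by linarith)
  have h1 : Real.exp (-1) < 1 / 2 := by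
    have := Real.exp_neg_one_lt_d9
    linarith
  linarith [key ℓ A hℓ hA, key t B (hℓ.trans hℓt) hB]

/-- If `log p₀ = C * log (1 - p₀)`, the Ramsey number of `(ℓ, C * ℓ)` has exponential growth rate
strictly above `p₀ ^ (-1 / 2)`. -/
lemma exists_graph_of_log_eq {C p₀ : ℝ} (hC : 1 < C) (hp₀ : 0 < p₀) (hp₀2 : p₀ < 1 / 2)
    (hlog : Real.log p₀ = C * Real.log (1 - p₀)) :
    ∃ ε : ℝ, 0 < ε ∧ ∃ ℓ0 : ℕ, ∀ ℓ : ℕ, ℓ0 ≤ ℓ →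
      ∀ n : ℕ, (n : ℝ) ≤ ((Real.sqrt p₀)⁻¹ + ε) ^ ℓ →
        ∃ G : SimpleGraph (Fin n),
          G.CliqueFree ℓ ∧ Gᶜ.CliqueFree ⌈C * (ℓ : ℝ)⌉₊ := by
  obtain ⟨s, N, hs, hs1, hN, hN4, hp2, hgap, hgain⟩ := exists_tilt_scale hp₀ hp₀2 hlog
  have hN0 : (0 : ℝ) < N := by exact_mod_cast hN
  set p : ℝ := p₀ * (1 + s / (3 * (N : ℝ) ^ 7)) with hp
  set c : ℝ := -Real.log p₀ / 2 with hc
  have hpos : 0 < 1 + s / (3 * (N : ℝ) ^ 7) := by positivity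
  have hp0 : 0 < p := mul_pos hp₀ hpos
  have hlogp : Real.log p = Real.log p₀ + Real.log (1 + s / (3 * (N : ℝ) ^ 7)) :=
    Real.log_mul hp₀.ne' hpos.ne'
  have hlo : -(2 * c) ≤ Real.log p := by
    have := Real.log_nonneg (x := 1 + s / (3 * (N : ℝ) ^ 7))
      (le_add_of_nonneg_right (by positivity))
    linarith
  have hhi : Real.log p ≤ -(2 * c) + s / (3 * (N : ℝ) ^ 7) := by
    linarith [Real.log_le_sub_one_of_pos hpos]
  have hcC : c = C * -Real.log (1 - p₀) / 2 := by rw [hc, hlog]; ring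
  set γ : ℝ := min ((1 - s - 192 / (N : ℝ) ^ 5) / (6 * N ^ 7)) (gain C p₀ s N / (6 * N ^ 7))
    with hγ
  have hγ0 : 0 < γ := lt_min (by positivity) (by positivity)
  set K : ℝ := max (c + 1 / 2) (C + 1) with hK
  have hsqrt : (Real.sqrt p₀)⁻¹ = Real.exp c := by
    rw [hc, neg_div, Real.exp_neg, Real.exp_half, Real.exp_log hp₀]
  obtain ⟨ℓ0, hℓ0⟩ := exists_nat_ge (max 1 ((K + 1) / (γ / 2)))
  refine ⟨Real.exp (c + γ / 2) - Real.exp c, sub_pos.2 (Real.exp_lt_exp.2 (by linarith)), ℓ0,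
    fun ℓ hℓℓ0 n hn => ?_⟩
  rw [hsqrt, add_sub_cancel] at hn
  have hℓmax : max 1 ((K + 1) / (γ / 2)) ≤ (ℓ : ℝ) := hℓ0.trans (by exact_mod_cast hℓℓ0)
  have hℓ' : (1 : ℝ) ≤ ℓ := (le_max_left _ _).trans hℓmax
  have hℓ : 1 ≤ ℓ := by exact_mod_cast hℓ'
  have hℓpos : (0 : ℝ) < ℓ := by linarith
  have hℓK : K + 1 ≤ ℓ * (γ - γ / 2) := by
    rw [sub_half, ← div_le_iff₀ (by positivity)]
    exact (le_max_right _ _).trans hℓmax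
  set t : ℕ := ⌈C * (ℓ : ℝ)⌉₊
  have ht : C * ℓ ≤ t := Nat.le_ceil _
  have ht' : (t : ℝ) ≤ C * ℓ + 1 := (Nat.ceil_lt_add_one (by positivity)).le
  have hℓt' : (ℓ : ℝ) ≤ t := (le_mul_of_one_le_left hℓpos.le hC.le).trans ht
  have hℓt : ℓ ≤ t := by exact_mod_cast hℓt'
  have htℓ : (t : ℝ) ≤ (C + 1) * ℓ := by linarith
  set a : ℝ := 1 / ((N : ℝ) ^ 5 * ℓ) with ha
  have htr : 2 * t * (N * a) ≤ 1 := by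
    calc 2 * t * (N * a) ≤ 2 * ((C + 1) * ℓ) * (N * a) := by gcongr
      _ = 2 * ((C + 1) / (N : ℝ) ^ 4) := by rw [ha]; field_simp
      _ ≤ 1 := hN4
  have hm := mul_mul_cube_le hℓpos hN0 htℓ ha rfl
  refine exists_graph_of_params (m := N ^ 8 * ℓ ^ 2) hℓ hℓt hp0.le hp2 (by positivity) rfl
    (by exact_mod_cast hN) htr (by linarith) rfl rfl
    (union_bound_lt_one (γ := γ) (K := K) hℓ hℓt hn hℓK
      ((clique_exponent_le hℓ hN hp0 hlo hhi ha).trans ?_)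
      ((indep_exponent_le hℓ hN hC.le hs hs1 hp₀ hp hp2 ha rfl rfl rfl rfl ht ht'
        hgain.le).trans ?_))
  · rw [mul_div_cancel_left₀ c two_ne_zero]
    gcongr
    · exact min_le_left _ _
    · exact le_max_left _ _
  · rw [← hcC]
    gcongr
    · exact min_le_right _ _
    · exact le_max_right _ _

end Main

end TiltedGraph

theorem ramsey_lower_bound (C : ℝ) (hC : 1 < C) (pC : ℝ) (hpC : IsPC C pC) :
    ∃ ε : ℝ, 0 < ε ∧ ∃ ℓ0 : ℕ, ∀ ℓ : ℕ, ℓ0 ≤ ℓ →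
      ∀ n : ℕ, (n : ℝ) ≤ ((Real.sqrt pC)⁻¹ + ε) ^ ℓ →
        ∃ G : SimpleGraph (Fin n),
          G.CliqueFree ℓ ∧ Gᶜ.CliqueFree ⌈C * (ℓ : ℝ)⌉₊ := by
  obtain ⟨⟨hp₀, hp₀2⟩, hCp⟩ := hpC
  have hb : Real.log (1 - pC) < 0 := Real.log_neg (by linarith) (by linarith)
  exact TiltedGraph.exists_graph_of_log_eq hC hp₀ hp₀2 (by rw [hCp, div_mul_cancel₀ _ hb.ne])
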